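/- Nonlinear Landau levels of the Chern–Simons–Schrödinger model (Section 5.4 Corollary). Let B > 0, β > 0 and let n be a nonnegative integer. If 2n > β - 2, then there exists exactly one radially symmetric, twice continuously differentiable ψ : ℝ² → ℝ satisfying -Δψ(x) = 4πβ·‖x‖^{2n}·e^{-B‖x‖²/2}·e^{ψ(x)} for every x ∈ ℝ² and ∫_{ℝ²} ‖x‖^{2n}·e^{-B‖x‖²/2}·e^{ψ(x)} dx = 1. Conversely, if there exists a continuous ψ : ℝ² → ℝ (not necessarily radially symmetric) which is a weak solution of -Δψ = 4πβ·‖x‖^{2n}·e^{-B‖x‖²/2}·e^{ψ} on ℝ², satisfies ∫_{ℝ²} ‖x‖^{2n}·e^{-B‖x‖²/2}·e^{ψ(x)} dx = 1, and ψ(x)/log‖x‖ → -2β as ‖x‖ → ∞, then 2n > β - 2. -/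

import Mathlib

open MeasureTheory Real Filter Bornology Metric
open scoped NNReal

noncomputable section

abbrev R2 : Type := EuclideanSpace ℝ (Fin 2)

/-- The Laplacian of `f : ℝ² → ℝ`, via the second iterated Fréchet derivative. -/
def lap (f : R2 → ℝ) (x : R2) : ℝ :=
  ∑ i : Fin 2, iteratedFDeriv ℝ 2 f x ![EuclideanSpace.single i 1, EuclideanSpace.single i 1]

/-- `ψ` is a weak (distributional) solution of `-Δψ = g` on `ℝ²`:
for every smooth compactly supported test function `φ`, `∫ ψ·Δφ = -∫ g·φ`. -/
def IsWeakSol (ψ g : R2 → ℝ) : Prop :=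
  ∀ φ : R2 → ℝ, ContDiff ℝ (⊤ : ℕ∞) φ → HasCompactSupport φ →
    ∫ x : R2, ψ x * lap φ x = -∫ x : R2, g x * φ x

/-- `f` is radially symmetric. -/
def RadSym (f : R2 → ℝ) : Prop := ∀ x y : R2, ‖x‖ = ‖y‖ → f x = f y

theorem normSq_eq (x : R2) : ‖x‖ ^ 2 = x 0 ^ 2 + x 1 ^ 2 := by
  rw [EuclideanSpace.norm_sq_eq]; simp

theorem lap_of_eventuallyEq_comp_normSq {f : R2 → ℝ} {v v1 : ℝ → ℝ} {v2 : ℝ} {x : R2}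
    (hf : f =ᶠ[nhds x] fun y => v (‖y‖ ^ 2))
    (hv : ∀ᶠ s in nhds (‖x‖ ^ 2), HasDerivAt v (v1 s) s)
    (hv1 : HasDerivAt v1 v2 (‖x‖ ^ 2)) :
    lap f x = 4 * (‖x‖ ^ 2 * v2 + v1 (‖x‖ ^ 2)) := by
  let p : Fin 2 → R2 →L[ℝ] ℝ := fun i => EuclideanSpace.proj i
  have hN : ∀ y : R2, HasFDerivAt (fun y : R2 => ‖y‖ ^ 2)
      ((2 * y 0) • p 0 + (2 * y 1) • p 1) y := fun y => by
    have e : (2 * y 0) • p 0 + (2 * y 1) • p 1 = 2 • innerSL ℝ y := by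
      refine ContinuousLinearMap.ext fun z => ?_
      simp [p, PiLp.inner_apply, Fin.sum_univ_two]
      ring
    rw [e]
    exact (hasStrictFDerivAt_norm_sq y).hasFDerivAt
  have hc : Tendsto (fun y : R2 => ‖y‖ ^ 2) (nhds x) (nhds (‖x‖ ^ 2)) :=
    (hN x).continuousAt.tendsto
  have h1 : fderiv ℝ f =ᶠ[nhds x]
      fun y => v1 (‖y‖ ^ 2) • ((2 * p 0 y) • p 0 + (2 * p 1 y) • p 1) := by
    filter_upwards [hf.eventuallyEq_nhds, hc.eventually hv] with y hy hvy
    rw [hy.fderiv_eq]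
    exact (hvy.comp_hasFDerivAt y (hN y)).fderiv
  have h2 := (hv1.comp_hasFDerivAt x (hN x)).smul
    ((((p 0).hasFDerivAt (x := x)).const_mul 2).smul_const (p 0) |>.add
      ((((p 1).hasFDerivAt (x := x)).const_mul 2).smul_const (p 1)))
  simp only [lap, iteratedFDeriv_two_apply, h1.fderiv_eq]
  erw [h2.fderiv]
  simp [p, normSq_eq]
  ring

theorem integral_comp_normSq (f : ℝ → ℝ) :
    ∫ x : R2, f (‖x‖ ^ 2) = π * ∫ s in Set.Ioi (0 : ℝ), f s := by
  have h := integral_fun_norm_addHaar (volume : Measure R2) (fun r => f (r ^ 2))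
  have h2 := integral_comp_rpow_Ioi f (p := 2) (by norm_num)
  have hvol : (volume : Measure R2).real (ball 0 1) = π := by
    rw [Measure.real, EuclideanSpace.volume_ball_fin_two]; simp [pi_pos.le]
  rw [h, ← h2, hvol]
  simp only [finrank_euclideanSpace, Fintype.card_fin, smul_eq_mul, nsmul_eq_mul]
  have : ∫ x in Set.Ioi (0 : ℝ), |(2:ℝ)| * x ^ ((2:ℝ) - 1) * f (x ^ (2:ℝ))
      = 2 * ∫ x in Set.Ioi (0 : ℝ), x ^ (2 - 1) * f (x ^ 2) := by
    rw [← integral_const_mul]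
    refine setIntegral_congr_fun measurableSet_Ioi fun x _ => ?_
    norm_num
    ring
  rw [this]
  push_cast
  ring

theorem exists_inverse_of_deriv_pos {m m' : ℝ → ℝ} {β : ℝ}
    (hm : ∀ s > 0, HasDerivAt m (m' s) s) (hpos : ∀ s > 0, 0 < m' s)
    (h0 : Tendsto m (nhdsWithin 0 (Set.Ioi 0)) (nhds 0)) (h1 : Tendsto m atTop (nhds β)) :
    ∃ T : ℝ → ℝ, (∀ s > 0, m s ∈ Set.Ioo 0 β ∧ T (m s) = s) ∧
      (∀ y ∈ Set.Ioo 0 β, 0 < T y ∧ m (T y) = y ∧ HasDerivAt T (m' (T y))⁻¹ y) ∧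
      Tendsto T (nhdsWithin 0 (Set.Ioi 0)) (nhdsWithin 0 (Set.Ioi 0)) ∧
      Tendsto T (nhdsWithin β (Set.Iio β)) atTop := by
  have hcont : ContinuousOn m (Set.Ioi 0) := fun s hs => (hm s hs).continuousAt.continuousWithinAt
  have hmono : StrictMonoOn m (Set.Ioi 0) := by
    refine strictMonoOn_of_deriv_pos (convex_Ioi 0) hcont fun s hs => ?_
    rw [interior_Ioi] at hs
    rw [(hm s hs).deriv]
    exact hpos s hs
  have hlow : ∀ s > 0, 0 ≤ m s := fun s hs => by
    refine le_of_tendsto h0 ?_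
    filter_upwards [Ioo_mem_nhdsGT hs] with t ht
    exact (hmono ht.1 hs ht.2).le
  have hlow' : ∀ s > 0, 0 < m s := fun s hs =>
    (hlow (s / 2) (by positivity)).trans_lt
      (hmono (Set.mem_Ioi.2 (by positivity)) hs (by linarith))
  have hup : ∀ s > 0, m s ≤ β := fun s hs => by
    refine ge_of_tendsto h1 ?_
    filter_upwards [eventually_gt_atTop s] with t ht
    exact (hmono hs (Set.mem_Ioi.2 (hs.trans ht)) ht).le
  have hup' : ∀ s > 0, m s < β := fun s hs =>
    (hmono hs (Set.mem_Ioi.2 (by positivity)) (by linarith : s < s + 1)).trans_le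
      (hup (s + 1) (by positivity))
  have hsurj : ∀ y ∈ Set.Ioo 0 β, ∃ s ∈ Set.Ioi (0 : ℝ), m s = y := fun y hy => by
    obtain ⟨s1, hs1, h1s⟩ := ((h0.eventually (gt_mem_nhds hy.1)).and self_mem_nhdsWithin).exists
    obtain ⟨s2, hs2, h2s⟩ := ((h1.eventually (lt_mem_nhds hy.2)).and
      (eventually_gt_atTop s1)).exists
    obtain ⟨s, hs, hsy⟩ := intermediate_value_Icc h2s.le
      (hcont.mono fun t ht => lt_of_lt_of_le h1s ht.1) ⟨hs1.le, hs2.le⟩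
    exact ⟨s, lt_of_lt_of_le h1s hs.1, hsy⟩
  choose! T hT0 hTm using hsurj
  have hTl : ∀ s > 0, T (m s) = s := fun s hs =>
    hmono.injOn (hT0 _ ⟨hlow' s hs, hup' s hs⟩) hs (hTm _ ⟨hlow' s hs, hup' s hs⟩)
  have hTlt : ∀ y ∈ Set.Ioo 0 β, ∀ s > 0, y < m s → T y < s := fun y hy s hs h => by
    rw [← hTm y hy] at h
    exact (hmono.lt_iff_lt (hT0 y hy) hs).1 h
  have hTgt : ∀ y ∈ Set.Ioo 0 β, ∀ s > 0, m s < y → s < T y := fun y hy s hs h => by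
    rw [← hTm y hy] at h
    exact (hmono.lt_iff_lt hs (hT0 y hy)).1 h
  have hTmono : StrictMonoOn T (Set.Ioo 0 β) := fun y hy z hz hyz =>
    hTlt y hy _ (hT0 z hz) (by rwa [hTm z hz])
  have hβ : 0 < β := (hlow' 1 one_pos).trans (hup' 1 one_pos)
  refine ⟨T, fun s hs => ⟨⟨hlow' s hs, hup' s hs⟩, hTl s hs⟩, fun y hy =>
    ⟨hT0 y hy, hTm y hy, ?_⟩, ?_, ?_⟩
  · have hc : ContinuousAt T y := by
      refine hTmono.continuousAt_of_image_mem_nhds (isOpen_Ioo.mem_nhds hy) ?_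
      filter_upwards [lt_mem_nhds (hT0 y hy)] with s hs
      exact ⟨m s, ⟨hlow' s hs, hup' s hs⟩, hTl s hs⟩
    refine HasDerivAt.of_local_left_inverse hc (hm _ (hT0 y hy)) (hpos _ (hT0 y hy)).ne' ?_
    filter_upwards [isOpen_Ioo.mem_nhds hy] with z hz using hTm z hz
  · rw [tendsto_nhdsWithin_iff]
    refine ⟨?_, ?_⟩
    · rw [tendsto_order]
      refine ⟨fun a ha => ?_, fun a ha => ?_⟩
      · filter_upwards [Ioo_mem_nhdsGT hβ] with y hy using ha.trans (hT0 y hy)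
      · filter_upwards [Ioo_mem_nhdsGT hβ, Ioo_mem_nhdsGT (hlow' a ha)] with y hy hy2
        exact hTlt y hy a ha hy2.2
    · filter_upwards [Ioo_mem_nhdsGT hβ] with y hy using hT0 y hy
  · rw [Filter.tendsto_atTop]
    intro a
    have ha : (0 : ℝ) < max a 1 := by positivity
    filter_upwards [Ioo_mem_nhdsLT hβ, Ioo_mem_nhdsLT (hup' _ ha)] with y hy hy2
    exact (le_max_left a 1).trans (hTgt y hy _ ha hy2.1).le

/-- `v` is a radial solution in the variable `s = r²`, with mass function `m = -s v'` of total
mass `β`. -/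
structure IsRadialProfile (b c β : ℝ) (n : ℕ) (m v : ℝ → ℝ) : Prop where
  hasDerivAt_v : ∀ s > 0, HasDerivAt v (-(m s) / s) s
  hasDerivAt_m : ∀ s > 0, HasDerivAt m (c * s ^ n * exp (-b * s) * exp (v s)) s
  tendsto_zero : Tendsto m (nhdsWithin 0 (Set.Ioi 0)) (nhds 0)
  tendsto_atTop : Tendsto m atTop (nhds β)
  bounded : ∃ C, ∀ᶠ s in nhdsWithin 0 (Set.Ioi 0), v s ≤ C

/-- The phase-plane derivative `s m'(s)` of a radial solution. -/
def phase (b c : ℝ) (n : ℕ) (v : ℝ → ℝ) (s : ℝ) : ℝ := s * (c * s ^ n * exp (-b * s) * exp (v s))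

theorem tendsto_pow_mul_exp_neg_mul {b : ℝ} (hb : 0 < b) (k : ℕ) :
    Tendsto (fun s : ℝ => s ^ k * exp (-b * s)) atTop (nhds 0) := by
  simpa using tendsto_rpow_mul_exp_neg_mul_atTop_nhds_zero k b hb

namespace IsRadialProfile

variable {b c β : ℝ} {n : ℕ} {m v : ℝ → ℝ}

theorem hasDerivAt_phase (h : IsRadialProfile b c β n m v) {s : ℝ} (hs : 0 < s) :
    HasDerivAt (phase b c n v)
      ((n + 1 - b * s - m s) * (c * s ^ n * exp (-b * s) * exp (v s))) s := by
  have e1 : HasDerivAt (fun s : ℝ => exp (-b * s)) (exp (-b * s) * (-b)) s := by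
    simpa using ((hasDerivAt_id s).const_mul (-b)).exp
  have e2 := (h.hasDerivAt_v s hs).exp
  have e3 := (((hasDerivAt_pow (n + 1) s).const_mul c).mul e1).mul e2
  refine (e3.congr_of_eventuallyEq (f₁ := phase b c n v) ?_).congr_deriv ?_
  · refine Eventually.of_forall fun t => ?_
    simp only [phase, Pi.mul_apply]
    ring
  · simp only [Pi.mul_apply, Nat.add_sub_cancel]
    push_cast
    field_simp
    ring

theorem phase_tendsto_zero (h : IsRadialProfile b c β n m v) (hc : 0 < c) :
    Tendsto (phase b c n v) (nhdsWithin 0 (Set.Ioi 0)) (nhds 0) := by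
  obtain ⟨C, hC⟩ := h.bounded
  have hlim : Tendsto (fun s : ℝ => s * (c * s ^ n * exp (-b * s) * exp C))
      (nhdsWithin 0 (Set.Ioi 0)) (nhds 0) := by
    have : Continuous fun s : ℝ => s * (c * s ^ n * exp (-b * s) * exp C) := by fun_prop
    simpa using (this.tendsto 0).mono_left nhdsWithin_le_nhds
  refine tendsto_of_tendsto_of_tendsto_of_le_of_le' tendsto_const_nhds hlim ?_ ?_
  · filter_upwards [self_mem_nhdsWithin] with s hs
    have hs : 0 < s := hs
    unfold phase; positivity
  · filter_upwards [self_mem_nhdsWithin, hC] with s hs h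
    have hs : 0 < s := hs
    unfold phase
    gcongr

theorem m_nonneg (h : IsRadialProfile b c β n m v) (hc : 0 < c) {s : ℝ} (hs : 0 < s) :
    0 < m s := by
  obtain ⟨T, hT, -⟩ := exists_inverse_of_deriv_pos h.hasDerivAt_m
    (fun s hs => by positivity) h.tendsto_zero h.tendsto_atTop
  exact (hT s hs).1.1

theorem phase_tendsto_atTop (h : IsRadialProfile b c β n m v) (hb : 0 < b) (hc : 0 < c) :
    Tendsto (phase b c n v) atTop (nhds 0) := by
  have hanti : AntitoneOn v (Set.Ioi 0) := by
    refine antitoneOn_of_deriv_nonpos (convex_Ioi 0)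
      (fun s hs => (h.hasDerivAt_v s hs).continuousAt.continuousWithinAt) ?_ ?_
    · rw [interior_Ioi]
      exact fun s hs => (h.hasDerivAt_v s hs).differentiableAt.differentiableWithinAt
    · rw [interior_Ioi]
      intro s hs
      rw [(h.hasDerivAt_v s hs).deriv]
      exact div_nonpos_of_nonpos_of_nonneg (neg_nonpos.2 (h.m_nonneg hc hs).le) (le_of_lt hs)
  have hlim : Tendsto (fun s : ℝ => c * exp (v 1) * (s ^ (n + 1) * exp (-b * s)))
      atTop (nhds 0) := by
    simpa using (tendsto_pow_mul_exp_neg_mul hb (n + 1)).const_mul (c * exp (v 1))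
  refine tendsto_of_tendsto_of_tendsto_of_le_of_le' tendsto_const_nhds hlim ?_ ?_
  · filter_upwards [eventually_gt_atTop 0] with s hs
    unfold phase; positivity
  · filter_upwards [eventually_ge_atTop 1] with s hs
    have hs0 : 0 < s := by linarith
    have : v s ≤ v 1 := hanti (Set.mem_Ioi.2 one_pos) hs0 hs
    calc phase b c n v s ≤ s * (c * s ^ n * exp (-b * s) * exp (v 1)) := by
          unfold phase; gcongr
      _ = _ := by ring

end IsRadialProfile

namespace IsRadialProfile

variable {b c β : ℝ} {n : ℕ} {m₁ v₁ m₂ v₂ : ℝ → ℝ}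

theorem sub_mul_log_sub_nonneg {x y : ℝ} (hx : 0 < x) (hy : 0 < y) :
    0 ≤ (x - y) * (log x - log y) := by
  rcases le_total x y with h | h
  · exact mul_nonneg_of_nonpos_of_nonpos (sub_nonpos.2 h) (sub_nonpos.2 (log_le_log hx h))
  · exact mul_nonneg (sub_nonneg.2 h) (sub_nonneg.2 (log_le_log hy h))

theorem sub_nonneg_of_log_sub_mul {d x y : ℝ} (hx : 0 < x) (hy : 0 < y)
    (h : 0 ≤ d * (log x - log y)) : 0 ≤ d * (x - y) := by
  rcases lt_trichotomy x y with hxy | hxy | hxy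
  · have := log_lt_log hx hxy
    have : d ≤ 0 := by by_contra hd; nlinarith
    nlinarith
  · simp [hxy]
  · have := log_lt_log hy hxy
    have : 0 ≤ d := by by_contra hd; nlinarith
    nlinarith

/-- Comparison in the phase plane: a solution `(D, log T₁ - log T₂)` of the difference system
which vanishes at both ends vanishes identically. -/
theorem eq_of_phase_comparison {D T₁ T₂ g₁ g₂ : ℝ → ℝ} (hb : 0 < b)
    (hT₁ : ∀ y ∈ Set.Ioo 0 β, 0 < T₁ y) (hT₂ : ∀ y ∈ Set.Ioo 0 β, 0 < T₂ y)
    (hg₁ : ∀ y ∈ Set.Ioo 0 β, 0 < g₁ y) (hg₂ : ∀ y ∈ Set.Ioo 0 β, 0 < g₂ y)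
    (hD : ∀ y ∈ Set.Ioo 0 β, D y = g₁ y - g₂ y)
    (hD' : ∀ y ∈ Set.Ioo 0 β, HasDerivAt D (-b * (T₁ y - T₂ y)) y)
    (hT₁' : ∀ y ∈ Set.Ioo 0 β, HasDerivAt (fun y => log (T₁ y)) (1 / g₁ y) y)
    (hT₂' : ∀ y ∈ Set.Ioo 0 β, HasDerivAt (fun y => log (T₂ y)) (1 / g₂ y) y)
    (h0 : Tendsto D (nhdsWithin 0 (Set.Ioi 0)) (nhds 0))
    (hβ : Tendsto D (nhdsWithin β (Set.Iio β)) (nhds 0)) :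
    ∀ y ∈ Set.Ioo 0 β, T₁ y = T₂ y := by
  set P : ℝ → ℝ := fun y => -D y * (log (T₁ y) - log (T₂ y)) with hP
  have hP' : ∀ y ∈ Set.Ioo 0 β, HasDerivAt P
      (b * ((T₁ y - T₂ y) * (log (T₁ y) - log (T₂ y))) + D y ^ 2 / (g₁ y * g₂ y)) y := by
    intro y hy
    refine ((hD' y hy).neg.mul ((hT₁' y hy).sub (hT₂' y hy))).congr_deriv ?_
    have := (hg₁ y hy).ne'
    have := (hg₂ y hy).ne'
    simp only [Pi.neg_apply, Pi.sub_apply, hD y hy]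
    field_simp
    ring
  have hPmono : MonotoneOn P (Set.Ioo 0 β) := by
    refine monotoneOn_of_deriv_nonneg (convex_Ioo 0 β)
      (fun y hy => (hP' y hy).continuousAt.continuousWithinAt) ?_ ?_
    · rw [interior_Ioo]
      exact fun y hy => (hP' y hy).differentiableAt.differentiableWithinAt
    · rw [interior_Ioo]
      intro y hy
      rw [(hP' y hy).deriv]
      have := sub_mul_log_sub_nonneg (hT₁ y hy) (hT₂ y hy)
      have := hg₁ y hy
      have := hg₂ y hy
      positivity
  have hD2 : ∀ y ∈ Set.Ioo 0 β,
      HasDerivAt (fun y => D y ^ 2) (2 * b * (-D y * (T₁ y - T₂ y))) y := fun y hy => by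
    refine ((hD' y hy).pow 2).congr_deriv ?_
    simp; ring
  have hsq0 : Tendsto (fun y => D y ^ 2) (nhdsWithin 0 (Set.Ioi 0)) (nhds 0) := by
    simpa using h0.pow 2
  have hsqβ : Tendsto (fun y => D y ^ 2) (nhdsWithin β (Set.Iio β)) (nhds 0) := by
    simpa using hβ.pow 2
  have hP0 : ∀ y ∈ Set.Ioo 0 β, P y = 0 := by
    intro y hy
    rcases lt_trichotomy (P y) 0 with hlt | heq | hgt
    · exfalso
      have hanti : AntitoneOn (fun y => D y ^ 2) (Set.Ioc 0 y) := by
        have hsub : ∀ z ∈ Set.Ioc 0 y, z ∈ Set.Ioo 0 β := fun z hz => ⟨hz.1, hz.2.trans_lt hy.2⟩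
        refine antitoneOn_of_deriv_nonpos (convex_Ioc 0 y)
          (fun z hz => (hD2 z (hsub z hz)).continuousAt.continuousWithinAt) ?_ ?_
        · rw [interior_Ioc]
          exact fun z hz =>
            (hD2 z (hsub z ⟨hz.1, hz.2.le⟩)).differentiableAt.differentiableWithinAt
        · rw [interior_Ioc]
          intro z hz
          have hz' := hsub z ⟨hz.1, hz.2.le⟩
          rw [(hD2 z hz').deriv]
          have h1 : P z < 0 := (hPmono hz' hy hz.2.le).trans_lt hlt
          have h2 := sub_nonneg_of_log_sub_mul (d := D z) (hT₁ z hz') (hT₂ z hz')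
            (by simp only [hP] at h1; linarith)
          nlinarith
      have hDy : 0 < D y ^ 2 := by
        have : D y ≠ 0 := fun h => by simp [hP, h] at hlt
        positivity
      have : D y ^ 2 ≤ 0 := by
        refine ge_of_tendsto hsq0 ?_
        filter_upwards [Ioo_mem_nhdsGT hy.1] with z hz
        exact hanti ⟨hz.1, hz.2.le⟩ ⟨hy.1, le_rfl⟩ hz.2.le
      linarith
    · exact heq
    · exfalso
      have hmono : MonotoneOn (fun y => D y ^ 2) (Set.Ico y β) := by
        have hsub : ∀ z ∈ Set.Ico y β, z ∈ Set.Ioo 0 β := fun z hz => ⟨hy.1.trans_le hz.1, hz.2⟩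
        refine monotoneOn_of_deriv_nonneg (convex_Ico y β)
          (fun z hz => (hD2 z (hsub z hz)).continuousAt.continuousWithinAt) ?_ ?_
        · rw [interior_Ico]
          exact fun z hz =>
            (hD2 z (hsub z ⟨hz.1.le, hz.2⟩)).differentiableAt.differentiableWithinAt
        · rw [interior_Ico]
          intro z hz
          have hz' := hsub z ⟨hz.1.le, hz.2⟩
          rw [(hD2 z hz').deriv]
          have h1 : 0 < P z := hgt.trans_le (hPmono hy hz' hz.1.le)
          have h2 := sub_nonneg_of_log_sub_mul (d := -D z) (hT₁ z hz') (hT₂ z hz') h1.le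
          positivity
      have hDy : 0 < D y ^ 2 := by
        have : D y ≠ 0 := fun h => by simp [hP, h] at hgt
        positivity
      have : D y ^ 2 ≤ 0 := by
        refine ge_of_tendsto hsqβ ?_
        filter_upwards [Ioo_mem_nhdsLT hy.2] with z hz
        exact hmono ⟨le_rfl, hy.2⟩ ⟨hz.1.le, hz.2⟩ hz.1.le
      linarith
  intro y hy
  have hz : b * ((T₁ y - T₂ y) * (log (T₁ y) - log (T₂ y))) + D y ^ 2 / (g₁ y * g₂ y) = 0 := by
    refine (hP' y hy).unique ((hasDerivAt_const y (0 : ℝ)).congr_of_eventuallyEq ?_)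
    filter_upwards [isOpen_Ioo.mem_nhds hy] with z hz using hP0 z hz
  have h1 := sub_mul_log_sub_nonneg (hT₁ y hy) (hT₂ y hy)
  have h2 : 0 ≤ D y ^ 2 / (g₁ y * g₂ y) := by
    have := hg₁ y hy
    have := hg₂ y hy
    positivity
  have h3 : (T₁ y - T₂ y) * (log (T₁ y) - log (T₂ y)) = 0 := by nlinarith
  rcases mul_eq_zero.1 h3 with h | h
  · linarith
  · exact log_injOn_pos (hT₁ y hy) (hT₂ y hy) (by linarith)

theorem eq (hb : 0 < b) (hc : 0 < c) (h₁ : IsRadialProfile b c β n m₁ v₁)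
    (h₂ : IsRadialProfile b c β n m₂ v₂) : ∀ s > 0, v₁ s = v₂ s := by
  obtain ⟨T₁, hs₁, hy₁, hz₁, hi₁⟩ := exists_inverse_of_deriv_pos h₁.hasDerivAt_m
    (fun s hs => by positivity) h₁.tendsto_zero h₁.tendsto_atTop
  obtain ⟨T₂, hs₂, hy₂, hz₂, hi₂⟩ := exists_inverse_of_deriv_pos h₂.hasDerivAt_m
    (fun s hs => by positivity) h₂.tendsto_zero h₂.tendsto_atTop
  have hphase : ∀ {m v T : ℝ → ℝ}, IsRadialProfile b c β n m v →
      (∀ y ∈ Set.Ioo 0 β, 0 < T y ∧ m (T y) = y ∧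
        HasDerivAt T (c * T y ^ n * exp (-b * T y) * exp (v (T y)))⁻¹ y) →
      ∀ y ∈ Set.Ioo 0 β,
        HasDerivAt (fun y => phase b c n v (T y)) (n + 1 - b * T y - y) y := by
    intro m v T h hT y hy
    obtain ⟨hT0, hTm, hT'⟩ := hT y hy
    refine ((h.hasDerivAt_phase hT0).comp y hT').congr_deriv ?_
    rw [hTm, mul_assoc, mul_inv_cancel₀ (by positivity), mul_one]
  have hlog : ∀ {m v T : ℝ → ℝ}, IsRadialProfile b c β n m v →
      (∀ y ∈ Set.Ioo 0 β, 0 < T y ∧ m (T y) = y ∧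
        HasDerivAt T (c * T y ^ n * exp (-b * T y) * exp (v (T y)))⁻¹ y) →
      ∀ y ∈ Set.Ioo 0 β,
        HasDerivAt (fun y => log (T y)) (1 / phase b c n v (T y)) y := by
    intro m v T h hT y hy
    obtain ⟨hT0, hTm, hT'⟩ := hT y hy
    refine (hT'.log hT0.ne').congr_deriv ?_
    unfold phase
    field_simp
  have hpos : ∀ (v : ℝ → ℝ) {s : ℝ}, 0 < s → 0 < phase b c n v s := fun v s hs => by
    unfold phase; positivity
  have hT : ∀ y ∈ Set.Ioo 0 β, T₁ y = T₂ y := by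
    refine eq_of_phase_comparison (D := fun y => phase b c n v₁ (T₁ y) - phase b c n v₂ (T₂ y))
      (g₁ := fun y => phase b c n v₁ (T₁ y)) (g₂ := fun y => phase b c n v₂ (T₂ y)) hb
      (fun y hy => (hy₁ y hy).1) (fun y hy => (hy₂ y hy).1)
      (fun y hy => hpos _ (hy₁ y hy).1) (fun y hy => hpos _ (hy₂ y hy).1) (fun _ _ => rfl)
      (fun y hy => ((hphase h₁ hy₁ y hy).sub (hphase h₂ hy₂ y hy)).congr_deriv (by ring))
      (hlog h₁ hy₁) (hlog h₂ hy₂) ?_ ?_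
    · simpa using ((h₁.phase_tendsto_zero hc).comp hz₁).sub ((h₂.phase_tendsto_zero hc).comp hz₂)
    · simpa using ((h₁.phase_tendsto_atTop hb hc).comp hi₁).sub
        ((h₂.phase_tendsto_atTop hb hc).comp hi₂)
  have hm : ∀ s > 0, m₁ s = m₂ s := fun s hs => by
    have h1 := hT _ (hs₁ s hs).1
    rw [(hs₁ s hs).2] at h1
    have h2 := (hy₂ _ (hs₁ s hs).1).2.1
    rw [← h1] at h2
    exact h2.symm
  intro s hs
  have h1 := (h₁.hasDerivAt_m s hs).unique ((h₂.hasDerivAt_m s hs).congr_of_eventuallyEq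
    (by filter_upwards [lt_mem_nhds hs] with t ht using hm t ht))
  have h2 : c * s ^ n * exp (-b * s) ≠ 0 := by positivity
  exact exp_injective (mul_left_cancel₀ h2 h1)

end IsRadialProfile

theorem exists_isRadialProfile {B β : ℝ} {n : ℕ} {ψ : R2 → ℝ} (hβ : 0 < β)
    (hrad : RadSym ψ) (hψ : ContDiff ℝ 2 ψ)
    (heq : ∀ x : R2, -lap ψ x = 4 * π * β * ‖x‖ ^ (2*n) *
      Real.exp (-B * ‖x‖ ^ 2 / 2) * Real.exp (ψ x))
    (hInt : (∫ x : R2, ‖x‖ ^ (2*n) * Real.exp (-B * ‖x‖ ^ 2 / 2) * Real.exp (ψ x)) = 1) :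
    ∃ m, IsRadialProfile (B / 2) (π * β) β n m
      (fun s => ψ (EuclideanSpace.single 0 (√s))) := by
  set p : ℝ → ℝ := fun r => ψ (EuclideanSpace.single 0 r) with hp
  set v : ℝ → ℝ := fun s => ψ (EuclideanSpace.single 0 (√s)) with hv
  have hsingle : (fun r : ℝ => (EuclideanSpace.single 0 r : R2)) =
      fun r => r • (EuclideanSpace.single 0 1 : R2) := by
    ext r i; simp
  have hp2 : ContDiff ℝ 2 p := by
    refine hψ.comp ?_
    change ContDiff ℝ 2 (fun r : ℝ => (EuclideanSpace.single 0 r : R2))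
    rw [hsingle]
    fun_prop
  have hψv : ∀ x, ψ x = v (‖x‖ ^ 2) := fun x => by
    refine hrad _ _ ?_
    simp [Real.sqrt_sq]
  have hvs : ∀ s > 0, ContDiffAt ℝ 2 v s := fun s hs => by
    have : v = p ∘ Real.sqrt := rfl
    rw [this]
    exact hp2.contDiffAt.comp s (Real.contDiffAt_sqrt (ne_of_gt hs))
  have hv1 : ∀ s > 0, HasDerivAt v (deriv v s) s := fun s hs =>
    ((hvs s hs).differentiableAt (by norm_num)).hasDerivAt
  have hv2 : ∀ s > 0, HasDerivAt (deriv v) (deriv (deriv v) s) s := fun s hs => by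
    have : ContDiffAt ℝ 1 (deriv v) s := by
      exact ((hvs s hs).fderiv_right (m := 1) (by norm_num)).clm_apply contDiffAt_const
    exact (this.differentiableAt (by norm_num)).hasDerivAt
  have hvd : ∀ s > 0, deriv v s = deriv p (√s) / (2 * √s) := fun s hs => by
    have h1 := ((hp2.differentiable (by norm_num)) (√s)).hasDerivAt.comp s
      (Real.hasDerivAt_sqrt (ne_of_gt hs))
    rw [show v = p ∘ Real.sqrt from rfl, h1.deriv]
    ring
  have hvcont : Continuous v := by
    rw [show v = p ∘ Real.sqrt from rfl]
    exact hp2.continuous.comp Real.continuous_sqrt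
  set m : ℝ → ℝ := fun s => -(s * deriv v s) with hm
  have hm' : ∀ s > 0, HasDerivAt m (π * β * s ^ n * exp (-(B / 2) * s) * exp (v s)) s := by
    intro s hs
    refine (((hasDerivAt_id s).mul (hv2 s hs)).neg).congr_deriv ?_
    have hx : ‖(EuclideanSpace.single 0 (√s) : R2)‖ ^ 2 = s := by
      simp [Real.sq_sqrt hs.le]
    have h1 := lap_of_eventuallyEq_comp_normSq (f := ψ) (v := v) (v1 := deriv v)
      (v2 := deriv (deriv v) s) (x := EuclideanSpace.single 0 (√s))
      (Eventually.of_forall hψv)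
      (by rw [hx]; filter_upwards [lt_mem_nhds hs] with t ht using hv1 t ht)
      (by rw [hx]; exact hv2 s hs)
    have h2 := heq (EuclideanSpace.single 0 (√s))
    rw [h1, pow_mul, hx] at h2
    have h3 : -B * s / 2 = -(B / 2) * s := by ring
    rw [h3] at h2
    simp only [id_eq, one_mul]
    change _ = _ * exp (ψ _)
    linarith
  have hm0 : Tendsto m (nhdsWithin 0 (Set.Ioi 0)) (nhds 0) := by
    have h1 : Continuous fun s => -(√s / 2 * deriv p (√s)) := by
      have := hp2.continuous_deriv (by norm_num)
      fun_prop
    have h2 := (h1.tendsto 0).mono_left (nhdsWithin_le_nhds (s := Set.Ioi 0))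
    simp only [Real.sqrt_zero, zero_div, zero_mul, neg_zero] at h2
    refine h2.congr' ?_
    filter_upwards [self_mem_nhdsWithin] with s hs
    have hs' : 0 < √s := Real.sqrt_pos.2 hs
    simp only [hm]
    rw [hvd s hs]
    have : s = √s * √s := (Real.mul_self_sqrt (le_of_lt hs)).symm
    nth_rewrite 3 [this]
    field_simp
  have hI : ∫ s in Set.Ioi (0 : ℝ), π * β * s ^ n * exp (-(B / 2) * s) * exp (v s) = β := by
    have h1 := integral_comp_normSq (fun s => s ^ n * exp (-(B / 2) * s) * exp (v s))
    have h2 : ∫ s in Set.Ioi (0 : ℝ), π * β * s ^ n * exp (-(B / 2) * s) * exp (v s) =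
        π * β * ∫ s in Set.Ioi (0 : ℝ), s ^ n * exp (-(B / 2) * s) * exp (v s) := by
      rw [← integral_const_mul]
      congr 1
      ext s
      ring
    rw [h2, mul_assoc, mul_left_comm, ← h1]
    have h3 : ∫ x : R2, (‖x‖ ^ 2) ^ n * exp (-(B / 2) * ‖x‖ ^ 2) * exp (v (‖x‖ ^ 2)) = 1 := by
      rw [← hInt]
      congr 1
      ext x
      rw [hψv x, pow_mul, show -B * ‖x‖ ^ 2 / 2 = -(B / 2) * ‖x‖ ^ 2 by ring]
    rw [h3, mul_one]
  refine ⟨m, ?_, hm', hm0, ?_, v 0 + 1, ?_⟩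
  · intro s hs
    refine (hv1 s hs).congr_deriv ?_
    simp only [hm]
    field_simp
  · have hInt' : IntegrableOn (fun s => π * β * s ^ n * exp (-(B / 2) * s) * exp (v s))
        (Set.Ioi 0) := by
      by_contra h
      rw [integral_undef h] at hI
      exact hβ.ne hI
    have h1 := tendsto_limUnder_of_hasDerivAt_of_integrableOn_Ioi hm' hInt'
    have hc : ContinuousWithinAt m (Set.Ici 0) 0 := by
      have : m 0 = 0 := by simp [hm]
      rw [← Set.Ioi_insert, continuousWithinAt_insert_self, ContinuousWithinAt, this]
      exact hm0
    have h2 := integral_Ioi_of_hasDerivAt_of_tendsto hc hm' hInt' h1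
    rw [hI] at h2
    have : m 0 = 0 := by simp [hm]
    rw [this, sub_zero] at h2
    rwa [← h2] at h1
  · have := (hvcont.tendsto 0).eventually (gt_mem_nhds (lt_add_one (v 0)))
    filter_upwards [this.filter_mono nhdsWithin_le_nhds] with s hs using hs.le

theorem eq_of_radial_solutions {B β : ℝ} {n : ℕ} {ψ₁ ψ₂ : R2 → ℝ} (hB : 0 < B) (hβ : 0 < β)
    (hψ₁ : RadSym ψ₁ ∧ ContDiff ℝ 2 ψ₁ ∧
      (∀ x : R2, -lap ψ₁ x = 4 * π * β * ‖x‖ ^ (2*n) *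
        Real.exp (-B * ‖x‖ ^ 2 / 2) * Real.exp (ψ₁ x)) ∧
      (∫ x : R2, ‖x‖ ^ (2*n) * Real.exp (-B * ‖x‖ ^ 2 / 2) * Real.exp (ψ₁ x)) = 1)
    (hψ₂ : RadSym ψ₂ ∧ ContDiff ℝ 2 ψ₂ ∧
      (∀ x : R2, -lap ψ₂ x = 4 * π * β * ‖x‖ ^ (2*n) *
        Real.exp (-B * ‖x‖ ^ 2 / 2) * Real.exp (ψ₂ x)) ∧
      (∫ x : R2, ‖x‖ ^ (2*n) * Real.exp (-B * ‖x‖ ^ 2 / 2) * Real.exp (ψ₂ x)) = 1) :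
    ψ₁ = ψ₂ := by
  obtain ⟨m₁, h₁⟩ := exists_isRadialProfile hβ hψ₁.1 hψ₁.2.1 hψ₁.2.2.1 hψ₁.2.2.2
  obtain ⟨m₂, h₂⟩ := exists_isRadialProfile hβ hψ₂.1 hψ₂.2.1 hψ₂.2.2.1 hψ₂.2.2.2
  have h := h₁.eq (by positivity) (by positivity) h₂
  have hne : Set.EqOn ψ₁ ψ₂ {0}ᶜ := fun x hx => by
    have hx' : 0 < ‖x‖ := norm_pos_iff.2 hx
    have := h (‖x‖ ^ 2) (by positivity)
    rw [hψ₁.1 x (EuclideanSpace.single 0 (√(‖x‖ ^ 2))) (by simp [Real.sqrt_sq]), this]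
    exact (hψ₂.1 x (EuclideanSpace.single 0 (√(‖x‖ ^ 2))) (by simp [Real.sqrt_sq])).symm
  exact hψ₁.2.1.continuous.ext_on (dense_compl_singleton 0) hψ₂.2.1.continuous hne

/-- The radial integral operator `∫₀^|s| ∫₀¹ F (τ θ) dθ dτ` inverting `(s u')' = F`. -/
def radialPrimitive (F : ℝ → ℝ) (s : ℝ) : ℝ := ∫ τ in (0 : ℝ)..|s|, ∫ θ in (0 : ℝ)..1, F (τ * θ)

/-- The weight for which the radial integral operator is a contraction. -/
def radialWeight (n : ℕ) (s : ℝ) : ℝ := exp (2 * |s| ^ (n + 1) / (n + 1))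

/-- The even extension of the potential `sⁿ e^{-ε s}`. -/
def evenPotential (n : ℕ) (ε s : ℝ) : ℝ := |s| ^ n * exp (-|ε| * |s|)

theorem continuous_radialPrimitive {X : Type*} [TopologicalSpace X] [FirstCountableTopology X]
    {F : X → ℝ → ℝ} (hF : Continuous (Function.uncurry F)) :
    Continuous fun p : X × ℝ => radialPrimitive (F p.1) p.2 := by
  unfold radialPrimitive
  have h1 : Continuous (Function.uncurry fun (p : X × ℝ) (θ : ℝ) => F p.1 (p.2 * θ)) := by
    have : Continuous fun q : (X × ℝ) × ℝ => (q.1.1, q.1.2 * q.2) := by fun_prop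
    exact hF.comp this
  have h2 := intervalIntegral.continuous_parametric_intervalIntegral_of_continuous' (μ := volume) h1 0 1
  have h3 : Continuous (Function.uncurry fun (p : X × ℝ) (τ : ℝ) =>
      ∫ θ in (0 : ℝ)..1, F p.1 (τ * θ)) := by
    have : Continuous fun q : (X × ℝ) × ℝ => (q.1.1, q.2) := by fun_prop
    exact h2.comp this
  exact intervalIntegral.continuous_parametric_intervalIntegral_of_continuous h3
    (by fun_prop : Continuous fun p : X × ℝ => |p.2|)

theorem continuous_average {F : ℝ → ℝ} (hF : Continuous F) :
    Continuous fun τ => ∫ θ in (0 : ℝ)..1, F (τ * θ) :=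
  intervalIntegral.continuous_parametric_intervalIntegral_of_continuous'
    (f := fun τ θ => F (τ * θ)) (by fun_prop) 0 1

theorem radialPrimitive_sub {F G : ℝ → ℝ} (hF : Continuous F) (hG : Continuous G) (s : ℝ) :
    radialPrimitive F s - radialPrimitive G s = radialPrimitive (fun t => F t - G t) s := by
  unfold radialPrimitive
  rw [← intervalIntegral.integral_sub ((continuous_average hF).intervalIntegrable _ _)
    ((continuous_average hG).intervalIntegrable _ _)]
  congr 1
  ext τ
  rw [← intervalIntegral.integral_sub]
  · exact Continuous.intervalIntegrable (by fun_prop) _ _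
  · exact Continuous.intervalIntegrable (by fun_prop) _ _

theorem one_le_radialWeight (n : ℕ) (s : ℝ) : 1 ≤ radialWeight n s := by
  unfold radialWeight
  exact one_le_exp (by positivity)

theorem radialWeight_mono (n : ℕ) {s t : ℝ} (hs : 0 ≤ s) (h : s ≤ t) :
    radialWeight n s ≤ radialWeight n t := by
  unfold radialWeight
  have : |s| ≤ |t| := by rwa [abs_of_nonneg hs, abs_of_nonneg (hs.trans h)]
  gcongr

theorem abs_radialPrimitive_le {n : ℕ} {F : ℝ → ℝ} {C : ℝ} (hC : 0 ≤ C)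
    (hF : ∀ t ≥ 0, |F t| ≤ C * (t ^ n * radialWeight n t)) (s : ℝ) :
    |radialPrimitive F s| ≤ C / 2 * radialWeight n s := by
  have hw : ∀ t ≥ 0, ∀ τ ≥ t, t ^ n * radialWeight n t ≤ τ ^ n * radialWeight n τ :=
    fun t ht τ hτ => by
      have := radialWeight_mono n ht hτ
      have := one_le_radialWeight n t
      have : 0 ≤ τ := ht.trans hτ
      gcongr
  have havg : ∀ τ ≥ 0, |∫ θ in (0 : ℝ)..1, F (τ * θ)| ≤ C * (τ ^ n * radialWeight n τ) := by
    intro τ hτ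
    have := intervalIntegral.norm_integral_le_of_norm_le_const (a := 0) (b := 1)
      (f := fun θ => F (τ * θ)) (C := C * (τ ^ n * radialWeight n τ)) ?_
    · simpa using this
    · intro θ hθ
      rw [Set.uIoc_of_le zero_le_one] at hθ
      refine (hF (τ * θ) (mul_nonneg hτ hθ.1.le)).trans ?_
      exact mul_le_mul_of_nonneg_left
        (hw _ (mul_nonneg hτ hθ.1.le) _ (mul_le_of_le_one_right hτ hθ.2)) hC
  have hder : ∀ t : ℝ, HasDerivAt (fun t : ℝ => exp (2 * t ^ (n + 1) / (n + 1)))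
      (2 * (t ^ n * exp (2 * t ^ (n + 1) / (n + 1)))) t := fun t => by
    have := (((hasDerivAt_pow (n + 1) t).const_mul 2).div_const ((n : ℝ) + 1)).exp
    refine this.congr_deriv ?_
    push_cast
    have : (n : ℝ) + 1 ≠ 0 := by positivity
    field_simp
  have hcont : Continuous fun t : ℝ => t ^ n * exp (2 * t ^ (n + 1) / (n + 1)) := by fun_prop
  have hInt : ∫ t in (0 : ℝ)..|s|, 2 * (t ^ n * exp (2 * t ^ (n + 1) / (n + 1))) =
      radialWeight n s - 1 := by
    rw [intervalIntegral.integral_eq_sub_of_hasDerivAt (fun t _ => hder t)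
      ((hcont.const_mul 2).intervalIntegrable _ _)]
    simp [radialWeight]
  have hbound := intervalIntegral.norm_integral_le_of_norm_le (a := 0) (b := |s|)
    (f := fun τ => ∫ θ in (0 : ℝ)..1, F (τ * θ))
    (g := fun t => C * (t ^ n * exp (2 * t ^ (n + 1) / (n + 1)))) (μ := volume) (abs_nonneg s)
    (Eventually.of_forall fun τ hτ => by
      have := havg τ hτ.1.le
      rwa [radialWeight, abs_of_pos hτ.1] at this)
    ((hcont.const_mul C).intervalIntegrable _ _)
  rw [intervalIntegral.integral_const_mul] at hbound hInt
  rw [Real.norm_eq_abs] at hbound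
  unfold radialPrimitive
  refine hbound.trans ?_
  have : C * (∫ t in (0 : ℝ)..|s|, t ^ n * exp (2 * t ^ (n + 1) / (n + 1))) =
      C / 2 * (radialWeight n s - 1) := by rw [← hInt]; ring
  rw [this]
  gcongr
  linarith

theorem abs_exp_min_zero_sub_le (x y : ℝ) : |exp (min x 0) - exp (min y 0)| ≤ |x - y| := by
  have key : ∀ a b : ℝ, a ≤ b → b ≤ 0 → exp b - exp a ≤ b - a := fun a b hab hb => by
    have h1 := add_one_le_exp (a - b)
    have h2 : exp a = exp b * exp (a - b) := by rw [← exp_add]; ring_nf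
    have h3 : exp b ≤ 1 := exp_le_one_iff.2 hb
    have h4 := exp_pos b
    rw [h2]
    nlinarith
  have hmin : |min x 0 - min y 0| ≤ |x - y| := by
    simpa using abs_min_sub_min_le_max x 0 y 0
  refine le_trans ?_ hmin
  rcases le_total (min x 0) (min y 0) with h | h
  · rw [abs_sub_comm, abs_sub_comm (min x 0), abs_of_nonneg (sub_nonneg.2 (exp_le_exp.2 h)),
      abs_of_nonneg (sub_nonneg.2 h)]
    exact key _ _ h (min_le_right _ _)
  · rw [abs_of_nonneg (sub_nonneg.2 (exp_le_exp.2 h)), abs_of_nonneg (sub_nonneg.2 h)]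
    exact key _ _ h (min_le_right _ _)

theorem continuous_radialWeight (n : ℕ) : Continuous (radialWeight n) := by
  unfold radialWeight
  fun_prop (disch := positivity)

theorem evenPotential_nonneg (n : ℕ) (ε s : ℝ) : 0 ≤ evenPotential n ε s := by
  unfold evenPotential; positivity

theorem evenPotential_le (n : ℕ) (ε : ℝ) {s : ℝ} (hs : 0 ≤ s) : evenPotential n ε s ≤ s ^ n := by
  unfold evenPotential
  rw [abs_of_nonneg hs]
  refine mul_le_of_le_one_right (by positivity) (exp_le_one_iff.2 ?_)
  have := mul_nonneg (abs_nonneg ε) hs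
  linarith

/-- The family `u ε` of normalised solutions of `(s u')' = -sⁿ e^{-ε s} e^u`, `u 0 = 0`, depending
continuously on the parameter. -/
theorem exists_radial_family (n : ℕ) : ∃ u : ℝ → ℝ → ℝ, Continuous (Function.uncurry u) ∧
    ∀ ε s, u ε s = -radialPrimitive (fun t => evenPotential n ε t * exp (u ε t)) s := by
  have hw0 : ∀ t, 0 < radialWeight n t := fun t => one_pos.trans_le (one_le_radialWeight n t)
  have hwc := continuous_radialWeight n
  have hpc : Continuous fun q : ℝ × ℝ => evenPotential n q.1 q.2 := by
    unfold evenPotential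
    fun_prop
  let G : BoundedContinuousFunction (ℝ × ℝ) ℝ → ℝ → ℝ → ℝ := fun f ε t =>
    evenPotential n ε t * exp (min (radialWeight n t * f (ε, t)) 0)
  have hG : ∀ f, Continuous (Function.uncurry (G f)) := fun f => by
    have : Continuous fun q : ℝ × ℝ =>
        evenPotential n q.1 q.2 * exp (min (radialWeight n q.2 * f (q.1, q.2)) 0) := by
      fun_prop
    exact this
  have hGε : ∀ f ε, Continuous (G f ε) := fun f ε =>
    (hG f).comp (by fun_prop : Continuous fun t : ℝ => (ε, t))
  have hGabs : ∀ f ε, ∀ t ≥ 0, |G f ε t| ≤ 1 * (t ^ n * radialWeight n t) := fun f ε t ht => by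
    have h1 : exp (min (radialWeight n t * f (ε, t)) 0) ≤ 1 := exp_le_one_iff.2 (min_le_right _ _)
    simp only [G]
    rw [abs_of_nonneg (mul_nonneg (evenPotential_nonneg n ε t) (exp_pos _).le), one_mul]
    exact mul_le_mul (evenPotential_le n ε ht) (h1.trans (one_le_radialWeight n t))
      (exp_pos _).le (by positivity)
  let Φ : BoundedContinuousFunction (ℝ × ℝ) ℝ → BoundedContinuousFunction (ℝ × ℝ) ℝ := fun f =>
    BoundedContinuousFunction.ofNormedAddCommGroup
      (fun q => -(radialPrimitive (G f q.1) q.2 / radialWeight n q.2))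
      ((continuous_radialPrimitive (hG f)).div (by fun_prop) (fun q => (hw0 _).ne')).neg
      (1 / 2) (fun q => by
        rw [norm_neg, norm_div, Real.norm_eq_abs, Real.norm_eq_abs, abs_of_pos (hw0 _),
          div_le_iff₀ (hw0 _)]
        exact abs_radialPrimitive_le zero_le_one (hGabs f q.1) q.2)
  have hΦ : ContractingWith (1 / 2) Φ := by
    refine ⟨by norm_num, LipschitzWith.of_dist_le_mul fun f g => ?_⟩
    rw [BoundedContinuousFunction.dist_le (by positivity)]
    rintro ⟨ε, s⟩
    have hle : ∀ t ≥ 0, |G f ε t - G g ε t| ≤ dist f g * (t ^ n * radialWeight n t) := by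
      intro t ht
      simp only [G]
      rw [← mul_sub, abs_mul, abs_of_nonneg (evenPotential_nonneg n ε t)]
      have h1 := abs_exp_min_zero_sub_le (radialWeight n t * f (ε, t)) (radialWeight n t * g (ε, t))
      rw [← mul_sub, abs_mul, abs_of_pos (hw0 t)] at h1
      have h2 : |f (ε, t) - g (ε, t)| ≤ dist f g := f.dist_coe_le_dist (g := g) (ε, t)
      calc _ ≤ t ^ n * (radialWeight n t * dist f g) :=
            mul_le_mul (evenPotential_le n ε ht)
              (h1.trans (mul_le_mul_of_nonneg_left h2 (hw0 t).le)) (abs_nonneg _) (by positivity)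
        _ = _ := by ring
    have h := abs_radialPrimitive_le dist_nonneg hle s
    rw [← radialPrimitive_sub (hGε f ε) (hGε g ε)] at h
    change |-(radialPrimitive (G f ε) s / radialWeight n s) -
      -(radialPrimitive (G g ε) s / radialWeight n s)| ≤ _
    rw [neg_sub_neg, abs_sub_comm, ← sub_div, abs_div, abs_of_pos (hw0 s), div_le_iff₀ (hw0 s)]
    refine h.trans (le_of_eq ?_)
    push_cast
    ring
  set f := hΦ.fixedPoint Φ
  have hf : ∀ ε s, radialWeight n s * f (ε, s) = -radialPrimitive (G f ε) s := fun ε s => by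
    have h1 : Φ f = f := hΦ.fixedPoint_isFixedPt
    have h2 : f (ε, s) = -(radialPrimitive (G f ε) s / radialWeight n s) := by
      conv_lhs => rw [← h1]
      rfl
    rw [h2]
    have := (hw0 s).ne'
    field_simp
  have hneg : ∀ ε s, radialWeight n s * f (ε, s) ≤ 0 := fun ε s => by
    rw [hf, neg_nonpos]
    unfold radialPrimitive
    refine intervalIntegral.integral_nonneg (abs_nonneg s) fun τ _ => ?_
    refine intervalIntegral.integral_nonneg zero_le_one fun θ _ => ?_
    exact mul_nonneg (evenPotential_nonneg n _ _) (exp_pos _).le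
  refine ⟨fun ε s => radialWeight n s * f (ε, s), ?_, fun ε s => ?_⟩
  · have : Continuous fun q : ℝ × ℝ => radialWeight n q.2 * f (q.1, q.2) := by fun_prop
    exact this
  · simp only [hf ε s]
    congr 2
    ext t
    simp only [G]
    rw [min_eq_left (hneg ε t), hf]

/-- The mean `∫₀¹ F (s θ) dθ` of `F` over `[0, s]`. -/
def segmentMean (F : ℝ → ℝ) (s : ℝ) : ℝ := ∫ θ in (0 : ℝ)..1, F (s * θ)

theorem continuous_segmentMean {F : ℝ → ℝ} (hF : Continuous F) : Continuous (segmentMean F) :=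
  continuous_average hF

theorem mul_segmentMean (F : ℝ → ℝ) (s : ℝ) : s * segmentMean F s = ∫ t in (0 : ℝ)..s, F t := by
  unfold segmentMean
  rw [intervalIntegral.mul_integral_comp_mul_left]
  simp

theorem hasDerivAt_segmentMean {F : ℝ → ℝ} (hF : ContDiff ℝ 1 F) (s : ℝ) :
    HasDerivAt (segmentMean F) (∫ θ in (0 : ℝ)..1, θ * deriv F (s * θ)) s := by
  have hd : Continuous (deriv F) := hF.continuous_deriv (by norm_num)
  have hc := hF.continuous
  obtain ⟨C, hC⟩ := (isCompact_closedBall (0 : ℝ) (|s| + 1)).exists_bound_of_continuousOn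
    hd.continuousOn
  refine (intervalIntegral.hasDerivAt_integral_of_dominated_loc_of_deriv_le
    (F := fun s θ => F (s * θ)) (F' := fun s θ => θ * deriv F (s * θ)) (x₀ := s)
    (s := Metric.ball s 1) (bound := fun _ => C) (Metric.ball_mem_nhds s one_pos) ?_ ?_ ?_ ?_ ?_ ?_).2
  · exact Eventually.of_forall fun x => Continuous.aestronglyMeasurable (by fun_prop)
  · exact Continuous.intervalIntegrable (by fun_prop) _ _
  · exact Continuous.aestronglyMeasurable (by fun_prop)
  · refine Eventually.of_forall fun θ hθ x hx => ?_
    rw [Set.uIoc_of_le zero_le_one] at hθ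
    rw [Metric.mem_ball, Real.dist_eq] at hx
    have h1 : |x| ≤ |s| + 1 := by
      have := abs_sub_abs_le_abs_sub x s
      linarith
    have h2 : |x * θ| ≤ |s| + 1 := by
      rw [abs_mul, abs_of_pos hθ.1]
      exact (mul_le_of_le_one_right (abs_nonneg x) hθ.2).trans h1
    have h3 := hC (x * θ) (by simpa using h2)
    rw [norm_mul, Real.norm_eq_abs, abs_of_pos hθ.1]
    exact (mul_le_of_le_one_left (norm_nonneg _) hθ.2).trans h3
  · exact intervalIntegrable_const
  · refine Eventually.of_forall fun θ _ x _ => ?_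
    have h1 := ((hF.differentiable (by norm_num)) (x * θ)).hasDerivAt.comp x
      ((hasDerivAt_id x).mul_const θ)
    exact h1.congr_deriv (by simp [mul_comm])

theorem contDiff_segmentMean {F : ℝ → ℝ} (hF : ContDiff ℝ 1 F) :
    ContDiff ℝ 1 (segmentMean F) := by
  have hd : Continuous (deriv F) := hF.continuous_deriv (by norm_num)
  rw [contDiff_one_iff_deriv]
  refine ⟨fun s => (hasDerivAt_segmentMean hF s).differentiableAt, ?_⟩
  rw [funext fun s => (hasDerivAt_segmentMean hF s).deriv]
  exact intervalIntegral.continuous_parametric_intervalIntegral_of_continuous' (μ := volume)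
    (f := fun s θ => θ * deriv F (s * θ)) (by fun_prop) 0 1

theorem hasDerivAt_integral_segmentMean {F : ℝ → ℝ} (hF : Continuous F) (s : ℝ) :
    HasDerivAt (fun s => ∫ τ in (0 : ℝ)..s, segmentMean F τ) (segmentMean F s) s :=
  ((continuous_segmentMean hF).integral_hasStrictDerivAt 0 s).hasDerivAt

/-- A continuous solution on `[0, ∞)` of the integrated radial equation is the restriction of a
`C²` function on `ℝ`. -/
theorem exists_contDiff_extension {h w : ℝ → ℝ} (hh : ContDiff ℝ 2 h) (hw : Continuous w)
    (heq : ∀ s ≥ 0, w s = -∫ τ in (0 : ℝ)..s, segmentMean (fun t => h t * exp (w t)) τ) :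
    ∃ v : ℝ → ℝ, ContDiff ℝ 2 v ∧ (∀ s ≥ 0, v s = w s) ∧
      ∀ s ≥ 0, s * deriv (deriv v) s + deriv v s = -(h s * exp (w s)) := by
  have hhc := hh.continuous
  have hcongr : ∀ {F G : ℝ → ℝ}, (∀ s ≥ 0, F s = G s) → ∀ s ≥ 0,
      ∫ τ in (0 : ℝ)..s, segmentMean F τ = ∫ τ in (0 : ℝ)..s, segmentMean G τ := by
    intro F G hFG s hs
    refine intervalIntegral.integral_congr fun τ hτ => ?_
    rw [Set.uIcc_of_le hs] at hτ
    refine intervalIntegral.integral_congr fun θ hθ => ?_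
    rw [Set.uIcc_of_le zero_le_one] at hθ
    exact hFG _ (mul_nonneg hτ.1 hθ.1)
  set F₁ : ℝ → ℝ := fun t => h t * exp (w t)
  have hF₁ : Continuous F₁ := by fun_prop
  set u : ℝ → ℝ := fun s => -∫ τ in (0 : ℝ)..s, segmentMean F₁ τ with hu
  have huw : ∀ s ≥ 0, u s = w s := fun s hs => (heq s hs).symm
  have hu1 : ContDiff ℝ 1 u := by
    rw [contDiff_one_iff_deriv]
    refine ⟨fun s => (hasDerivAt_integral_segmentMean hF₁ s).neg.differentiableAt, ?_⟩
    have hud : deriv u = fun s => -segmentMean F₁ s :=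
      funext fun s => (hasDerivAt_integral_segmentMean hF₁ s).neg.deriv
    rw [hud]
    exact (continuous_segmentMean hF₁).neg
  set F₂ : ℝ → ℝ := fun t => h t * exp (u t)
  have hF₂ : ContDiff ℝ 1 F₂ := (hh.of_le (by norm_num)).mul hu1.exp
  set v : ℝ → ℝ := fun s => -∫ τ in (0 : ℝ)..s, segmentMean F₂ τ with hv
  have hvd : deriv v = fun s => -segmentMean F₂ s :=
    funext fun s => (hasDerivAt_integral_segmentMean hF₂.continuous s).neg.deriv
  have hvw : ∀ s ≥ 0, v s = w s := fun s hs => by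
    rw [heq s hs, hv]
    simp only
    rw [hcongr (G := F₁) (fun t ht => by simp only [F₁, F₂]; rw [huw t ht]) s hs]
  refine ⟨v, ?_, hvw, fun s hs => ?_⟩
  · rw [show (2 : WithTop ℕ∞) = 1 + 1 by norm_num, contDiff_succ_iff_deriv]
    refine ⟨fun s => (hasDerivAt_integral_segmentMean hF₂.continuous s).neg.differentiableAt,
      by simp, ?_⟩
    rw [hvd]
    exact (contDiff_segmentMean hF₂).neg
  · have h1 := hasDerivAt_segmentMean hF₂ s
    have h2 : HasDerivAt (fun s => s * segmentMean F₂ s) (F₂ s) s := by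
      rw [funext (mul_segmentMean F₂)]
      exact (hF₂.continuous.integral_hasStrictDerivAt 0 s).hasDerivAt
    have h3 := ((hasDerivAt_id s).mul h1).unique h2
    have h4 : deriv (deriv v) s = -∫ θ in (0 : ℝ)..1, θ * deriv F₂ (s * θ) := by
      rw [hvd]
      exact h1.neg.deriv
    have h5 : F₂ s = h s * exp (w s) := by simp only [F₂, huw s hs]
    rw [h4, hvd, ← h5, ← h3, id_eq]
    ring

section RadialFamily

variable {n : ℕ} {u : ℝ → ℝ → ℝ}

theorem radial_family_eq
    (hu : ∀ ε s, u ε s = -radialPrimitive (fun t => evenPotential n ε t * exp (u ε t)) s)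
    (ε : ℝ) {s : ℝ} (hs : 0 ≤ s) :
    u ε s = -∫ τ in (0 : ℝ)..s, segmentMean (fun t => evenPotential n ε t * exp (u ε t)) τ := by
  conv_lhs => rw [hu, radialPrimitive, abs_of_nonneg hs]
  rfl

theorem radial_family_nonpos
    (hu : ∀ ε s, u ε s = -radialPrimitive (fun t => evenPotential n ε t * exp (u ε t)) s)
    (ε s : ℝ) : u ε s ≤ 0 := by
  rw [hu, neg_nonpos]
  unfold radialPrimitive
  refine intervalIntegral.integral_nonneg (abs_nonneg s) fun τ _ => ?_
  refine intervalIntegral.integral_nonneg zero_le_one fun θ _ => ?_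
  exact mul_nonneg (evenPotential_nonneg n _ _) (exp_pos _).le

theorem continuous_radial_density (huc : Continuous (Function.uncurry u)) :
    Continuous fun q : ℝ × ℝ => evenPotential n q.1 q.2 * exp (u q.1 q.2) := by
  have : Continuous fun q : ℝ × ℝ => u q.1 q.2 := huc
  unfold evenPotential
  fun_prop

theorem exists_mass_gt (huc : Continuous (Function.uncurry u))
    (hu : ∀ ε s, u ε s = -radialPrimitive (fun t => evenPotential n ε t * exp (u ε t)) s)
    {β : ℝ} (hβ : β < 2 * (n + 1)) :
    ∃ R > 0, β < ∫ t in (0 : ℝ)..R, evenPotential n 0 t * exp (u 0 t) := by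
  set G : ℝ → ℝ := fun t => evenPotential n 0 t * exp (u 0 t) with hG
  have hGc : Continuous G :=
    (continuous_radial_density huc).comp (by fun_prop : Continuous fun t : ℝ => ((0 : ℝ), t))
  set m : ℝ → ℝ := fun s => ∫ t in (0 : ℝ)..s, G t with hm
  have hm' : ∀ s, HasDerivAt m (G s) s := fun s => (hGc.integral_hasStrictDerivAt 0 s).hasDerivAt
  have hG0 : ∀ s, 0 ≤ G s := fun s => mul_nonneg (evenPotential_nonneg n _ _) (exp_pos _).le
  have hGs : ∀ s > 0, G s = s ^ n * exp (u 0 s) := fun s hs => by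
    simp [hG, evenPotential, abs_of_pos hs]
  have hu' : ∀ s > 0, HasDerivAt (u 0) (-segmentMean G s) s := fun s hs => by
    refine (hasDerivAt_integral_segmentMean hGc s).neg.congr_of_eventuallyEq ?_
    filter_upwards [lt_mem_nhds hs] with t ht using radial_family_eq hu 0 ht.le
  have hmono : Monotone m := monotone_of_deriv_nonneg (fun s => (hm' s).differentiableAt)
    fun s => by rw [(hm' s).deriv]; exact hG0 s
  by_contra! hcon
  have hid : ∀ s > 0, s * G s = m s * (n + 1 - m s / 2) := by
    set D : ℝ → ℝ := fun s => s * G s - m s * (n + 1 - m s / 2) with hD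
    have hmc : Continuous m := continuous_iff_continuousAt.2 fun s => (hm' s).continuousAt
    have hDc : Continuous D := by fun_prop
    have hD' : ∀ s > 0, HasDerivAt D 0 s := fun s hs => by
      have h1 : HasDerivAt (fun s => s * G s) ((n + 1 - m s) * G s) s := by
        have h2 := (hasDerivAt_pow (n + 1) s).mul (hu' s hs).exp
        refine (h2.congr_of_eventuallyEq ?_).congr_deriv ?_
        · filter_upwards [lt_mem_nhds hs] with t ht
          rw [hGs t ht, Pi.mul_apply]
          ring
        · have h3 : s * segmentMean G s = m s := mul_segmentMean G s
          rw [hGs s hs, ← h3]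
          push_cast
          ring
      have h4 := h1.sub ((hm' s).mul (((hm' s).div_const 2).const_sub ((n : ℝ) + 1)))
      refine h4.congr_deriv ?_
      ring
    intro s hs
    obtain ⟨c, -, hc⟩ := exists_hasDerivAt_eq_slope D (fun _ => 0) hs hDc.continuousOn
      fun x hx => hD' x hx.1
    have h6 : D s = D 0 := by
      rw [eq_comm, div_eq_zero_iff] at hc
      rcases hc with hc | hc <;> linarith
    have h7 : D 0 = 0 := by simp [hD, hm]
    rw [h7] at h6
    exact sub_eq_zero.1 h6
  have hm1 : 0 < m 1 := by
    refine intervalIntegral.intervalIntegral_pos_of_pos_on (hGc.intervalIntegrable _ _) ?_ one_pos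
    intro x hx
    rw [hGs x hx.1]
    have := hx.1
    positivity
  set γ := (n : ℝ) + 1 - β / 2 with hγ
  have hγ0 : 0 < γ := by linarith
  have hlog : MonotoneOn (fun s => m s - γ * m 1 * log s) (Set.Ici 1) := by
    have hdd : ∀ s > 0, HasDerivAt (fun s => m s - γ * m 1 * log s) (G s - γ * m 1 * s⁻¹) s :=
      fun s hs => (hm' s).sub ((hasDerivAt_log hs.ne').const_mul _)
    refine monotoneOn_of_deriv_nonneg (convex_Ici 1) ?_ ?_ ?_
    · exact fun s hs => (hdd s (one_pos.trans_le hs)).continuousAt.continuousWithinAt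
    · intro s hs
      rw [interior_Ici] at hs
      exact (hdd s (one_pos.trans hs)).differentiableAt.differentiableWithinAt
    · intro s hs
      rw [interior_Ici] at hs
      have hs0 : 0 < s := one_pos.trans hs
      rw [(hdd s hs0).deriv, sub_nonneg, ← div_eq_mul_inv, div_le_iff₀ hs0, mul_comm (G s), hid s hs0]
      have h1 : m 1 ≤ m s := hmono hs.le
      have h2 : m s ≤ β := hcon s hs0
      rw [mul_comm]
      exact mul_le_mul h1 (by linarith) hγ0.le (hm1.le.trans h1)
  have hpos : 0 < γ * m 1 := mul_pos hγ0 hm1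
  have hβ0 : 0 ≤ β := hm1.le.trans (hcon 1 one_pos)
  have h1 := hlog (Set.mem_Ici.2 le_rfl)
    (Set.mem_Ici.2 (one_le_exp (div_nonneg hβ0 hpos.le))) (one_le_exp (div_nonneg hβ0 hpos.le))
  simp only [log_one, mul_zero, sub_zero, log_exp] at h1
  rw [mul_div_cancel₀ _ hpos.ne'] at h1
  have h2 := hcon _ (exp_pos (β / (γ * m 1)))
  change m _ ≤ β at h2
  linarith

theorem exists_mass_eq (huc : Continuous (Function.uncurry u))
    (hu : ∀ ε s, u ε s = -radialPrimitive (fun t => evenPotential n ε t * exp (u ε t)) s)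
    {β : ℝ} (hβ0 : 0 < β) (hβ : β < 2 * (n + 1)) :
    ∃ ε > 0, ∫ t in Set.Ioi (0 : ℝ), evenPotential n ε t * exp (u ε t) = β := by
  set G : ℝ → ℝ → ℝ := fun ε t => evenPotential n ε t * exp (u ε t) with hG
  have hGc : Continuous fun q : ℝ × ℝ => G q.1 q.2 := continuous_radial_density huc
  have hGc1 : ∀ ε, Continuous (G ε) := fun ε => hGc.comp (by fun_prop : Continuous fun t : ℝ => (ε, t))
  have hG0 : ∀ ε s, 0 ≤ G ε s := fun ε s => mul_nonneg (evenPotential_nonneg n _ _) (exp_pos _).le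
  have hGle : ∀ ε₁ > 0, ∀ ε ≥ ε₁, ∀ t > 0, G ε t ≤ t ^ n * exp (-ε₁ * t) := by
    intro ε₁ h1 ε hε t ht
    refine (mul_le_of_le_one_right (evenPotential_nonneg n _ _)
      (exp_le_one_iff.2 (radial_family_nonpos hu ε t))).trans ?_
    rw [evenPotential, abs_of_pos ht, abs_of_pos (h1.trans_le hε)]
    gcongr
  have hI : ∀ ε > 0, IntegrableOn (fun t : ℝ => t ^ n * exp (-ε * t)) (Set.Ioi 0) ∧
      ∫ t in Set.Ioi (0 : ℝ), t ^ n * exp (-ε * t) = (1 / ε) ^ (n + 1) * n.factorial := by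
    intro ε hε
    have h1 := Real.integral_rpow_mul_exp_neg_mul_Ioi (a := n + 1) (r := ε) (by positivity) hε
    have h2 : ∀ t : ℝ, t ^ ((n : ℝ) + 1 - 1) * exp (-(ε * t)) = t ^ n * exp (-ε * t) := fun t => by
      rw [add_sub_cancel_right, rpow_natCast, neg_mul]
    simp only [h2] at h1
    rw [Real.Gamma_nat_eq_factorial] at h1
    have h3 : (1 / ε) ^ ((n : ℝ) + 1) = (1 / ε) ^ (n + 1) := by
      rw [← rpow_natCast]; push_cast; rfl
    rw [h3] at h1
    refine ⟨?_, h1⟩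
    by_contra hne
    rw [integral_undef hne] at h1
    have : 0 < (1 / ε) ^ (n + 1) * n.factorial := by positivity
    linarith
  have hGI : ∀ ε > 0, IntegrableOn (G ε) (Set.Ioi 0) := fun ε hε => by
    refine (hI ε hε).1.mono' (hGc1 ε).aestronglyMeasurable ?_
    filter_upwards [ae_restrict_mem measurableSet_Ioi] with t ht
    rw [Real.norm_eq_abs, abs_of_nonneg (hG0 ε t)]
    exact hGle ε hε ε le_rfl t ht
  set M : ℝ → ℝ := fun ε => ∫ t in Set.Ioi (0 : ℝ), G ε t with hM
  have hMle : ∀ ε > 0, M ε ≤ (1 / ε) ^ (n + 1) * n.factorial := fun ε hε => by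
    rw [← (hI ε hε).2]
    exact setIntegral_mono_on (hGI ε hε) (hI ε hε).1 measurableSet_Ioi
      fun t ht => hGle ε hε ε le_rfl t ht
  obtain ⟨R, hR0, hR⟩ := exists_mass_gt huc hu hβ
  have hmR : Continuous fun ε => ∫ t in (0 : ℝ)..R, G ε t :=
    intervalIntegral.continuous_parametric_intervalIntegral_of_continuous' (μ := volume) hGc 0 R
  obtain ⟨ε₁, hε₁, hM₁⟩ : ∃ ε₁ > 0, β < M ε₁ := by
    have h1 : ∀ᶠ ε in nhdsWithin 0 (Set.Ioi 0), β < ∫ t in (0 : ℝ)..R, G ε t :=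
      (hmR.tendsto 0).mono_left nhdsWithin_le_nhds |>.eventually (lt_mem_nhds hR)
    obtain ⟨ε, h2, h3⟩ := (h1.and self_mem_nhdsWithin).exists
    refine ⟨ε, h3, h2.trans_le ?_⟩
    rw [intervalIntegral.integral_of_le hR0.le]
    exact setIntegral_mono_set (hGI ε h3) (Eventually.of_forall (hG0 ε))
      (Eventually.of_forall fun t ht => ht.1)
  obtain ⟨ε₂, hε₂, hM₂⟩ : ∃ ε₂ ≥ ε₁, M ε₂ ≤ β := by
    have h1 : Tendsto (fun ε : ℝ => (1 / ε) ^ (n + 1) * n.factorial) atTop (nhds 0) := by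
      have : Tendsto (fun ε : ℝ => 1 / ε) atTop (nhds 0) := by
        simpa using tendsto_inv_atTop_zero (𝕜 := ℝ)
      simpa using (this.pow (n + 1)).mul_const (n.factorial : ℝ)
    obtain ⟨ε, h2, h3⟩ := ((h1.eventually (gt_mem_nhds hβ0)).and (eventually_ge_atTop ε₁)).exists
    exact ⟨ε, h3, (hMle ε (hε₁.trans_le h3)).trans h2.le⟩
  have hMc : ContinuousOn M (Set.Icc ε₁ ε₂) := by
    refine continuousOn_of_dominated (bound := fun t => t ^ n * exp (-ε₁ * t)) ?_ ?_ ?_ ?_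
    · exact fun ε _ => (hGc1 ε).aestronglyMeasurable
    · intro ε hε
      filter_upwards [ae_restrict_mem measurableSet_Ioi] with t ht
      rw [Real.norm_eq_abs, abs_of_nonneg (hG0 ε t)]
      exact hGle ε₁ hε₁ ε hε.1 t ht
    · exact (hI ε₁ hε₁).1
    · exact Eventually.of_forall fun t =>
        (hGc.comp (by fun_prop : Continuous fun ε : ℝ => (ε, t))).continuousOn
  obtain ⟨ε, hε, hMε⟩ := intermediate_value_Icc' hε₂ hMc ⟨hM₂, hM₁.le⟩
  exact ⟨ε, hε₁.trans_le hε.1, hMε⟩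

end RadialFamily

theorem exists_radial_profile (n : ℕ) {β : ℝ} (hβ0 : 0 < β) (hβ : β < 2 * (n + 1)) :
    ∃ ε > 0, ∃ v : ℝ → ℝ, ContDiff ℝ 2 v ∧
      (∀ s ≥ 0, s * deriv (deriv v) s + deriv v s = -(s ^ n * exp (-ε * s) * exp (v s))) ∧
      ∫ s in Set.Ioi (0 : ℝ), s ^ n * exp (-ε * s) * exp (v s) = β := by
  obtain ⟨u, huc, hu⟩ := exists_radial_family n
  obtain ⟨ε, hε, hM⟩ := exists_mass_eq huc hu hβ0 hβ
  have hpot : ∀ s ≥ 0, evenPotential n ε s = s ^ n * exp (-ε * s) := fun s hs => by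
    rw [evenPotential, abs_of_nonneg hs, abs_of_pos hε]
  have hw : Continuous (u ε) := huc.comp (by fun_prop : Continuous fun t : ℝ => (ε, t))
  obtain ⟨v, hv, hvw, hode⟩ := exists_contDiff_extension (h := fun s => s ^ n * exp (-ε * s))
    (w := u ε) (by fun_prop) hw fun s hs => by
      rw [radial_family_eq hu ε hs]
      congr 1
      refine intervalIntegral.integral_congr fun τ hτ => ?_
      rw [Set.uIcc_of_le hs] at hτ
      refine intervalIntegral.integral_congr fun θ hθ => ?_
      rw [Set.uIcc_of_le zero_le_one] at hθ
      simp only [hpot _ (mul_nonneg hτ.1 hθ.1)]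
  refine ⟨ε, hε, v, hv, fun s hs => by rw [hode s hs, hvw s hs], ?_⟩
  rw [← hM]
  refine setIntegral_congr_fun measurableSet_Ioi fun s hs => ?_
  have hs : 0 ≤ s := le_of_lt hs
  simp only [hpot s hs, hvw s hs]

theorem exists_radial_solution {B β : ℝ} (hB : 0 < B) (hβ : 0 < β) {n : ℕ}
    (hn : β - 2 < 2 * (n : ℝ)) :
    ∃ ψ : R2 → ℝ, RadSym ψ ∧ ContDiff ℝ 2 ψ ∧
      (∀ x : R2, -lap ψ x = 4 * π * β * ‖x‖ ^ (2*n) *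
        Real.exp (-B * ‖x‖ ^ 2 / 2) * Real.exp (ψ x)) ∧
      (∫ x : R2, ‖x‖ ^ (2*n) * Real.exp (-B * ‖x‖ ^ 2 / 2) * Real.exp (ψ x)) = 1 := by
  obtain ⟨ε, hε, v, hv, hode, hInt⟩ := exists_radial_profile n hβ (by linarith : β < 2 * (n + 1))
  set κ := B / 2 / ε with hκ
  have hκ0 : 0 < κ := by positivity
  have hκε : ε * κ = B / 2 := by rw [hκ]; field_simp
  have hc0 : 0 < κ ^ (n + 1) / (π * β) := by positivity
  set a := log (κ ^ (n + 1) / (π * β)) with ha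
  have hea : exp a = κ ^ (n + 1) / (π * β) := exp_log hc0
  set V : ℝ → ℝ := fun s => a + v (κ * s) with hV
  have hv1 : ∀ s, HasDerivAt v (deriv v s) s := fun s =>
    (hv.differentiable (by norm_num) s).hasDerivAt
  have hv2 : ∀ s, HasDerivAt (deriv v) (deriv (deriv v) s) s := fun s =>
    ((hv.iterate_deriv' 1 1).differentiable (by norm_num) s).hasDerivAt
  have hκs : ∀ s, HasDerivAt (fun s => κ * s) κ s := fun s => by
    simpa using (hasDerivAt_id s).const_mul κ
  have hV1 : ∀ s, HasDerivAt V (κ * deriv v (κ * s)) s := fun s =>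
    (((hv1 (κ * s)).comp s (hκs s)).const_add a).congr_deriv (mul_comm _ _)
  have hV2 : ∀ s, HasDerivAt (fun s => κ * deriv v (κ * s)) (κ * (κ * deriv (deriv v) (κ * s))) s :=
    fun s => (((hv2 (κ * s)).comp s (hκs s)).const_mul κ).congr_deriv (by ring)
  have hexp : ∀ s, exp (-ε * (κ * s)) = exp (-B * s / 2) := fun s => by
    rw [show -ε * (κ * s) = -(ε * κ) * s by ring, hκε]
    ring_nf
  refine ⟨fun x => V (‖x‖ ^ 2), fun x y hxy => by simp only [hxy], ?_, fun x => ?_, ?_⟩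
  · have : ContDiff ℝ 2 V := contDiff_const.add (hv.comp (by fun_prop))
    exact this.comp (contDiff_norm_sq ℝ)
  · rw [lap_of_eventuallyEq_comp_normSq (Eventually.of_forall fun _ => rfl)
      (Eventually.of_forall hV1) (hV2 _)]
    have h1 := hode (κ * ‖x‖ ^ 2) (by positivity)
    rw [hexp] at h1
    simp only [hV]
    rw [exp_add, hea, pow_mul]
    have h2 : ‖x‖ ^ 2 * (κ * (κ * deriv (deriv v) (κ * ‖x‖ ^ 2))) + κ * deriv v (κ * ‖x‖ ^ 2) =
        κ * -((κ * ‖x‖ ^ 2) ^ n * exp (-B * ‖x‖ ^ 2 / 2) * exp (v (κ * ‖x‖ ^ 2))) := by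
      rw [← h1]; ring
    rw [h2, mul_pow]
    field_simp
    ring
  · have h1 := integral_comp_normSq fun s => s ^ n * exp (-B * s / 2) * exp (V s)
    simp only [← pow_mul] at h1
    rw [h1]
    have h2 := integral_comp_mul_left_Ioi (fun s => s ^ n * exp (-ε * s) * exp (v s)) 0 hκ0
    rw [mul_zero, hInt] at h2
    have h3 : ∀ s, s ^ n * exp (-B * s / 2) * exp (V s) =
        κ / (π * β) * ((κ * s) ^ n * exp (-ε * (κ * s)) * exp (v (κ * s))) := fun s => by
      simp only [hV]
      rw [exp_add, hea, hexp]
      ring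
    simp only [h3]
    rw [integral_const_mul, h2]
    simp only [smul_eq_mul]
    field_simp

/-- The partial derivative `∂ᵢ f`. -/
def pderiv (i : Fin 2) (f : R2 → ℝ) (x : R2) : ℝ := fderiv ℝ f x (EuclideanSpace.single i 1)

theorem hasDerivAt_pderiv {f : R2 → ℝ} {x : R2} (hf : DifferentiableAt ℝ f x) (i : Fin 2) :
    HasDerivAt (fun t : ℝ => f (x + t • EuclideanSpace.single i 1)) (pderiv i f x) 0 :=
  hf.hasFDerivAt.hasLineDerivAt _

theorem pderiv_eq {f : R2 → ℝ} {x : R2} {i : Fin 2} {c : ℝ} (hf : DifferentiableAt ℝ f x)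
    (h : HasDerivAt (fun t : ℝ => f (x + t • EuclideanSpace.single i 1)) c 0) :
    pderiv i f x = c :=
  (hasDerivAt_pderiv hf i).unique h

theorem hasDerivAt_coord (x : R2) (i j : Fin 2) :
    HasDerivAt (fun t : ℝ => (x + t • (EuclideanSpace.single i 1 : R2)) j)
      (if j = i then 1 else 0) 0 := by
  simp only [PiLp.add_apply, PiLp.smul_apply, PiLp.single_apply, smul_eq_mul]
  simpa using ((hasDerivAt_id (0 : ℝ)).mul_const (if j = i then (1 : ℝ) else 0)).const_add (x j)

theorem ContDiff.pderiv {f : R2 → ℝ} {m k : WithTop ℕ∞} (hf : ContDiff ℝ k f) (hmk : m + 1 ≤ k)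
    (i : Fin 2) : ContDiff ℝ m (pderiv i f) :=
  (hf.fderiv_right hmk).clm_apply contDiff_const

theorem HasCompactSupport.pderiv {f : R2 → ℝ} (hf : HasCompactSupport f) (i : Fin 2) :
    HasCompactSupport (pderiv i f) :=
  hf.fderiv_apply (𝕜 := ℝ) _

theorem pderiv_pderiv {f : R2 → ℝ} (hf : ContDiff ℝ 2 f) (i j : Fin 2) (x : R2) :
    pderiv i (pderiv j f) x =
      fderiv ℝ (fderiv ℝ f) x (EuclideanSpace.single i 1) (EuclideanSpace.single j 1) := by
  have h : DifferentiableAt ℝ (fderiv ℝ f) x :=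
    (hf.fderiv_right (m := 1) (by norm_num)).differentiable (by norm_num) x
  have h2 := (h.hasFDerivAt.clm_apply (hasFDerivAt_const (EuclideanSpace.single j (1 : ℝ)) x)).fderiv
  change fderiv ℝ (fun y => fderiv ℝ f y (EuclideanSpace.single j 1)) x _ = _
  rw [h2]
  simp

theorem pderiv_comm {f : R2 → ℝ} (hf : ContDiff ℝ 2 f) (i j : Fin 2) (x : R2) :
    pderiv i (pderiv j f) x = pderiv j (pderiv i f) x := by
  rw [pderiv_pderiv hf, pderiv_pderiv hf]
  exact (hf.contDiffAt.isSymmSndFDerivAt (by simp)) _ _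

theorem lap_eq_pderiv {f : R2 → ℝ} (hf : ContDiff ℝ 2 f) (x : R2) :
    lap f x = pderiv 0 (pderiv 0 f) x + pderiv 1 (pderiv 1 f) x := by
  simp only [lap, Fin.sum_univ_two, iteratedFDeriv_two_apply, pderiv_pderiv hf]
  simp

theorem integral_pderiv_eq_zero {f : R2 → ℝ} (hf : ContDiff ℝ 1 f) (hs : HasCompactSupport f)
    (i : Fin 2) : ∫ x, pderiv i f x = 0 := by
  have hc : Continuous (_root_.pderiv i f) := (hf.pderiv (m := 0) (by norm_num) i).continuous
  have hInt := hc.integrable_of_hasCompactSupport (μ := volume) (hs.pderiv i)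
  unfold _root_.pderiv at hInt ⊢
  have h := integral_mul_fderiv_eq_neg_fderiv_mul_of_integrable (μ := (volume : Measure R2))
    (𝕜 := ℝ) (f := fun _ : R2 => (1 : ℝ)) (g := f) (v := EuclideanSpace.single i (1 : ℝ))
    (by simp) (by simpa only [one_mul] using hInt)
    (by simpa only [one_mul] using hf.continuous.integrable_of_hasCompactSupport hs)
    (fun x _ => differentiableAt_const _) (fun x _ => hf.differentiable (by norm_num) x)
  simpa using h

theorem pderiv_comp_normSq {v : ℝ → ℝ} {v' : ℝ} {x : R2} (hv : HasDerivAt v v' (‖x‖ ^ 2))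
    (i : Fin 2) : pderiv i (fun y => v (‖y‖ ^ 2)) x = 2 * x i * v' := by
  have h := hv.comp_hasFDerivAt x (hasStrictFDerivAt_norm_sq x).hasFDerivAt
  have h2 : fderiv ℝ (fun y : R2 => v (‖y‖ ^ 2)) x = _ := h.fderiv
  rw [pderiv, h2]
  simp [EuclideanSpace.inner_single_right]
  ring

/-- The convolution `∫ ψ(y) φ(x - y) dy`. -/
def mollify (φ ψ : R2 → ℝ) (x : R2) : ℝ := ∫ y, ψ y * φ (x - y)

theorem pderiv_mollify {φ ψ : R2 → ℝ} (hφ : ContDiff ℝ 1 φ) (hs : HasCompactSupport φ)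
    (hψ : Continuous ψ) (i : Fin 2) : pderiv i (mollify φ ψ) = mollify (pderiv i φ) ψ := by
  funext x
  have h := hs.hasFDerivAt_convolution_right (ContinuousLinearMap.mul ℝ ℝ) (μ := volume)
    (hψ.locallyIntegrable) hφ x
  have h2 : fderiv ℝ (mollify φ ψ) x = _ := h.fderiv
  rw [pderiv, h2, convolution_precompR_apply _ hψ.locallyIntegrable (hs.fderiv ℝ)
    (hφ.continuous_fderiv one_ne_zero)]
  rfl

theorem contDiff_mollify {φ ψ : R2 → ℝ} {k : ℕ∞} (hφ : ContDiff ℝ k φ) (hs : HasCompactSupport φ)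
    (hψ : Continuous ψ) : ContDiff ℝ k (mollify φ ψ) :=
  hs.contDiff_convolution_right (ContinuousLinearMap.mul ℝ ℝ) (μ := volume)
    hψ.locallyIntegrable hφ

theorem pderiv_comp_const_sub {φ : R2 → ℝ} (hφ : Differentiable ℝ φ) (i : Fin 2) (x : R2) :
    pderiv i (fun y => φ (x - y)) = fun y => -pderiv i φ (x - y) := by
  funext y
  have h := (hφ (x - y)).hasFDerivAt.comp y ((hasFDerivAt_id y).const_sub x)
  have h2 : fderiv ℝ (fun y => φ (x - y)) y = _ := h.fderiv
  rw [pderiv, h2]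
  simp [pderiv]

theorem lap_comp_const_sub {φ : R2 → ℝ} (hφ : ContDiff ℝ 2 φ) (x y : R2) :
    lap (fun y => φ (x - y)) y = lap φ (x - y) := by
  have h1 : ContDiff ℝ 2 fun y => φ (x - y) := hφ.comp (by fun_prop)
  have h2 : ∀ i, pderiv i (pderiv i fun y => φ (x - y)) y = pderiv i (pderiv i φ) (x - y) := by
    intro i
    have h3 := (hφ.pderiv (m := 1) (by norm_num) i)
    rw [pderiv_comp_const_sub (hφ.differentiable (by norm_num))]
    have h4 := pderiv_comp_const_sub (h3.differentiable (by norm_num)) i x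
    have h5 : fderiv ℝ (fun y => -pderiv i φ (x - y)) y =
      -fderiv ℝ (fun y => pderiv i φ (x - y)) y := fderiv_fun_neg
    have h6 := congrFun h4 y
    rw [pderiv, h5]
    rw [pderiv] at h6
    rw [neg_apply, h6, neg_neg]
  rw [lap_eq_pderiv h1, lap_eq_pderiv hφ, h2, h2]

theorem lap_mollify {φ ψ g : R2 → ℝ} (hφ : ContDiff ℝ (⊤ : ℕ∞) φ) (hs : HasCompactSupport φ)
    (hψ : Continuous ψ) (hw : IsWeakSol ψ g) (x : R2) :
    lap (mollify φ ψ) x = -mollify φ g x := by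
  have hφ2 : ContDiff ℝ 2 φ := contDiff_infty.1 hφ 2
  have h1 : ∀ i, pderiv i (pderiv i (mollify φ ψ)) x = mollify (pderiv i (pderiv i φ)) ψ x := by
    intro i
    rw [pderiv_mollify (hφ2.of_le (by norm_num)) hs hψ,
      pderiv_mollify (hφ2.pderiv (by norm_num) i) (hs.pderiv i) hψ]
  have hInt : ∀ i, Integrable fun y => ψ y * pderiv i (pderiv i φ) (x - y) := fun i => by
    have hc : Continuous (pderiv i (pderiv i φ)) :=
      ((hφ2.pderiv (m := 1) (by norm_num) i).pderiv (m := 0) (by norm_num) i).continuous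
    exact ((hs.pderiv i).pderiv i).convolutionExists_right (ContinuousLinearMap.mul ℝ ℝ)
      (μ := volume) hψ.locallyIntegrable hc x
  have h2 := hw (fun y => φ (x - y)) (hφ.comp (by fun_prop))
    (hs.comp_homeomorph (Homeomorph.subLeft x))
  have h3 : ContDiff ℝ 2 (mollify φ ψ) :=
    contDiff_mollify (k := 2) (by exact_mod_cast hφ2) hs hψ
  rw [lap_eq_pderiv h3, h1, h1, mollify, mollify, mollify, ← integral_add (hInt 0) (hInt 1), ← h2]
  congr 1
  ext y
  rw [lap_comp_const_sub hφ2, lap_eq_pderiv hφ2]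
  ring

theorem exists_mollification {ψ g : R2 → ℝ} (hψ : Continuous ψ) (hg : Continuous g)
    (hw : IsWeakSol ψ g) (R : ℝ) {ε : ℝ} (hε : 0 < ε) :
    ∃ ψ' : R2 → ℝ, ContDiff ℝ (⊤ : ℕ∞) ψ' ∧ (∀ x, ‖x‖ ≤ R → |ψ' x - ψ x| ≤ ε) ∧
      ∀ x, ‖x‖ ≤ R → |lap ψ' x + g x| ≤ ε := by
  have hunif : ∀ {f : R2 → ℝ}, Continuous f → ∃ δ > 0, ∀ x, ‖x‖ ≤ R → ∀ y ∈ ball x δ,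
      dist (f y) (f x) ≤ ε := by
    intro f hf
    have hc : IsCompact (closedBall (0 : R2) (R + 1)) := isCompact_closedBall _ _
    obtain ⟨δ, hδ, h⟩ := Metric.uniformContinuousOn_iff.1
      (hc.uniformContinuousOn_of_continuous hf.continuousOn) ε hε
    refine ⟨min δ 1, by positivity, fun x hx y hy => ?_⟩
    rw [mem_ball] at hy
    have h1 : dist y x < 1 := hy.trans_le (min_le_right _ _)
    refine (h y ?_ x ?_ (hy.trans_le (min_le_left _ _))).le
    · rw [mem_closedBall_zero_iff]
      rw [dist_eq_norm] at h1
      have := norm_sub_norm_le y x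
      linarith
    · rw [mem_closedBall_zero_iff]
      linarith
  obtain ⟨δ₁, hδ₁, h₁⟩ := hunif hψ
  obtain ⟨δ₂, hδ₂, h₂⟩ := hunif hg
  have hδ : 0 < min δ₁ δ₂ := lt_min hδ₁ hδ₂
  let b : ContDiffBump (0 : R2) := ⟨min δ₁ δ₂ / 2, min δ₁ δ₂, half_pos hδ, half_lt_self hδ⟩
  have hmol : ∀ f : R2 → ℝ, ∀ x, mollify (b.normed volume) f x =
      convolution (b.normed volume) f (ContinuousLinearMap.lsmul ℝ ℝ) volume x := fun f x => by
    rw [convolution_lsmul_swap]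
    simp only [mollify, smul_eq_mul, mul_comm]
  refine ⟨mollify (b.normed volume) ψ,
    contDiff_mollify b.contDiff_normed b.hasCompactSupport_normed hψ, fun x hx => ?_, fun x hx => ?_⟩
  · rw [hmol, ← Real.dist_eq]
    exact b.dist_normed_convolution_le hψ.aestronglyMeasurable
      fun y hy => h₁ x hx y (ball_subset_ball (min_le_left _ _) hy)
  · rw [lap_mollify b.contDiff_normed b.hasCompactSupport_normed hψ hw, hmol, neg_add_eq_sub,
      ← Real.dist_eq, dist_comm]
    exact b.dist_normed_convolution_le hg.aestronglyMeasurable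
      fun y hy => h₂ x hx y (ball_subset_ball (min_le_right _ _) hy)

/-- The squared length of the gradient. -/
def gradSq (f : R2 → ℝ) (x : R2) : ℝ := pderiv 0 f x ^ 2 + pderiv 1 f x ^ 2

/-- The Euler (radial) derivative `x · ∇f`. -/
def eulerDeriv (f : R2 → ℝ) (x : R2) : ℝ := x 0 * pderiv 0 f x + x 1 * pderiv 1 f x

theorem continuous_pderiv {f : R2 → ℝ} (hf : ContDiff ℝ 1 f) (i : Fin 2) :
    Continuous (pderiv i f) :=
  (hf.pderiv (m := 0) (by norm_num) i).continuous

theorem continuous_gradSq {f : R2 → ℝ} (hf : ContDiff ℝ 1 f) : Continuous (gradSq f) := by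
  have h0 := continuous_pderiv hf 0
  have h1 := continuous_pderiv hf 1
  unfold gradSq
  fun_prop

theorem continuous_eulerDeriv {f : R2 → ℝ} (hf : ContDiff ℝ 1 f) : Continuous (eulerDeriv f) := by
  have h0 := continuous_pderiv hf 0
  have h1 := continuous_pderiv hf 1
  unfold eulerDeriv
  fun_prop

theorem continuous_lap {f : R2 → ℝ} (hf : ContDiff ℝ 2 f) : Continuous (lap f) := by
  rw [funext (lap_eq_pderiv hf)]
  exact (continuous_pderiv (hf.pderiv (by norm_num) 0) 0).add
    (continuous_pderiv (hf.pderiv (by norm_num) 1) 1)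

theorem gradSq_eq_zero_of_notMem {f : R2 → ℝ} {x : R2} (hx : x ∉ tsupport f) : gradSq f x = 0 := by
  simp [gradSq, pderiv, fderiv_of_notMem_tsupport (𝕜 := ℝ) hx]

theorem integrable_of_tsupport {f ζ : R2 → ℝ} (hζ : HasCompactSupport ζ) (hf : Continuous f)
    (h : ∀ x, x ∉ tsupport ζ → f x = 0) : Integrable f :=
  hf.integrable_of_hasCompactSupport (HasCompactSupport.intro hζ h)

theorem integral_divergence_eq_zero {V₀ V₁ : R2 → ℝ} (h₀ : ContDiff ℝ 1 V₀) (h₁ : ContDiff ℝ 1 V₁)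
    (hs₀ : HasCompactSupport V₀) (hs₁ : HasCompactSupport V₁) :
    Integrable (fun x => pderiv 0 V₀ x + pderiv 1 V₁ x) ∧
      ∫ x, (pderiv 0 V₀ x + pderiv 1 V₁ x) = 0 := by
  have i₀ := (continuous_pderiv h₀ 0).integrable_of_hasCompactSupport (μ := volume) (hs₀.pderiv 0)
  have i₁ := (continuous_pderiv h₁ 1).integrable_of_hasCompactSupport (μ := volume) (hs₁.pderiv 1)
  refine ⟨i₀.add i₁, ?_⟩
  rw [integral_add i₀ i₁, integral_pderiv_eq_zero h₀ hs₀, integral_pderiv_eq_zero h₁ hs₁, add_zero]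

/-- Caccioppoli's inequality. -/
theorem integral_sq_mul_gradSq_le {w ζ : R2 → ℝ} (hw : ContDiff ℝ 2 w) (hζ : ContDiff ℝ 1 ζ)
    (hs : HasCompactSupport ζ) :
    ∫ x, ζ x ^ 2 * gradSq w x ≤
      4 * (∫ x, w x ^ 2 * gradSq ζ x) - 2 * ∫ x, ζ x ^ 2 * (w x * lap w x) := by
  have hw1 : ContDiff ℝ 1 w := hw.of_le (by norm_num)
  have hV : ∀ i, ContDiff ℝ 1 fun x => ζ x ^ 2 * (w x * pderiv i w x) := fun i => by
    have := hw.pderiv (m := 1) (by norm_num) i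
    fun_prop
  have hVs : ∀ i, HasCompactSupport fun x => ζ x ^ 2 * (w x * pderiv i w x) := fun i =>
    HasCompactSupport.intro hs fun x hx => by simp [image_eq_zero_of_notMem_tsupport hx]
  obtain ⟨hI, h0⟩ := integral_divergence_eq_zero (hV 0) (hV 1) (hVs 0) (hVs 1)
  have hd : ∀ i x, pderiv i (fun x => ζ x ^ 2 * (w x * pderiv i w x)) x =
      2 * ζ x * pderiv i ζ x * (w x * pderiv i w x) +
        ζ x ^ 2 * (pderiv i w x ^ 2 + w x * pderiv i (pderiv i w) x) := by
    intro i x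
    refine pderiv_eq ((hV i).differentiable (by norm_num) x) ?_
    have h1 := hasDerivAt_pderiv (hζ.differentiable (by norm_num) x) i
    have h2 := hasDerivAt_pderiv (hw1.differentiable (by norm_num) x) i
    have h3 := hasDerivAt_pderiv
      ((hw.pderiv (m := 1) (by norm_num) i).differentiable (by norm_num) x) i
    refine ((h1.pow 2).mul (h2.mul h3)).congr_deriv ?_
    simp only [Pi.pow_apply, Pi.mul_apply, zero_smul, add_zero]
    push_cast
    ring
  have hcw := hw.continuous
  have hcζ := hζ.continuous
  have hgw := continuous_gradSq hw1
  have hgζ := continuous_gradSq hζ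
  have hlw := continuous_lap hw
  have i1 : Integrable fun x => ζ x ^ 2 * gradSq w x :=
    integrable_of_tsupport hs (by fun_prop) fun x hx => by
      simp [image_eq_zero_of_notMem_tsupport hx]
  have i2 : Integrable fun x => w x ^ 2 * gradSq ζ x :=
    integrable_of_tsupport hs (by fun_prop) fun x hx => by simp [gradSq_eq_zero_of_notMem hx]
  have i3 : Integrable fun x => ζ x ^ 2 * (w x * lap w x) :=
    integrable_of_tsupport hs (by fun_prop) fun x hx => by
      simp [image_eq_zero_of_notMem_tsupport hx]
  have hle := integral_mono i1 (((i2.const_mul 4).sub (i3.const_mul 2)).add (hI.const_mul 2))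
    fun x => by
      simp only [Pi.add_apply, Pi.sub_apply, hd, lap_eq_pderiv hw, gradSq]
      nlinarith [sq_nonneg (2 * w x * pderiv 0 ζ x + ζ x * pderiv 0 w x),
        sq_nonneg (2 * w x * pderiv 1 ζ x + ζ x * pderiv 1 w x)]
  rw [integral_add' ((i2.const_mul 4).sub (i3.const_mul 2)) (hI.const_mul 2),
    integral_sub' (i2.const_mul 4) (i3.const_mul 2), integral_const_mul, integral_const_mul,
    integral_const_mul, h0] at hle
  linarith

/-- The localised Pohozaev identity. -/
theorem pohozaev {ψ χ K κ : R2 → ℝ} (hψ : ContDiff ℝ 2 ψ) (hχ : ContDiff ℝ 1 χ)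
    (hs : HasCompactSupport χ) (hK : ContDiff ℝ 1 K) (hκ : ∀ i x, pderiv i χ x = -κ x * x i) :
    ∫ x, (exp (ψ x) * (χ x * (2 * K x + eulerDeriv K x) - κ x * ‖x‖ ^ 2 * K x) +
      χ x * (lap ψ x + K x * exp (ψ x)) * eulerDeriv ψ x -
      κ x * (eulerDeriv ψ x ^ 2 - ‖x‖ ^ 2 * gradSq ψ x / 2)) = 0 := by
  have hψ1 : ContDiff ℝ 1 ψ := hψ.of_le (by norm_num)
  set p := pderiv 0 ψ with hp
  set q := pderiv 1 ψ with hq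
  have hpc : ContDiff ℝ 1 p := hψ.pderiv (by norm_num) 0
  have hqc : ContDiff ℝ 1 q := hψ.pderiv (by norm_num) 1
  have hx : ∀ i : Fin 2, ContDiff ℝ 1 fun x : R2 => x i := fun i => by fun_prop
  have hx0 := hx 0
  have hx1 := hx 1
  set V₀ : R2 → ℝ := fun x => χ x * (1 / 2 * (p x ^ 2 - q x ^ 2) * x 0 + p x * q x * x 1 +
    exp (ψ x) * K x * x 0) with hV₀
  set V₁ : R2 → ℝ := fun x => χ x * (p x * q x * x 0 - 1 / 2 * (p x ^ 2 - q x ^ 2) * x 1 +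
    exp (ψ x) * K x * x 1) with hV₁
  have c₀ : ContDiff ℝ 1 V₀ := by fun_prop
  have c₁ : ContDiff ℝ 1 V₁ := by fun_prop
  have s₀ : HasCompactSupport V₀ := hs.mul_right
  have s₁ : HasCompactSupport V₁ := hs.mul_right
  rw [← (integral_divergence_eq_zero c₀ c₁ s₀ s₁).2]
  congr 1
  ext x
  have dχ := fun i => hasDerivAt_pderiv (hχ.differentiable (by norm_num) x) i
  have dp := fun i => hasDerivAt_pderiv (hpc.differentiable (by norm_num) x) i
  have dq := fun i => hasDerivAt_pderiv (hqc.differentiable (by norm_num) x) i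
  have dψ := fun i => hasDerivAt_pderiv (hψ1.differentiable (by norm_num) x) i
  have dK := fun i => hasDerivAt_pderiv (hK.differentiable (by norm_num) x) i
  have h₀ := pderiv_eq (c₀.differentiable (by norm_num) x) (i := 0) ((dχ 0).mul
    (((((((dp 0).pow 2).sub ((dq 0).pow 2)).const_mul (1 / 2)).mul (hasDerivAt_coord x 0 0)).add
      (((dp 0).mul (dq 0)).mul (hasDerivAt_coord x 0 1))).add
      (((dψ 0).exp.mul (dK 0)).mul (hasDerivAt_coord x 0 0))))
  have h₁ := pderiv_eq (c₁.differentiable (by norm_num) x) (i := 1) ((dχ 1).mul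
    (((((dp 1).mul (dq 1)).mul (hasDerivAt_coord x 1 0)).sub
      (((((dp 1).pow 2).sub ((dq 1).pow 2)).const_mul (1 / 2)).mul (hasDerivAt_coord x 1 1))).add
      (((dψ 1).exp.mul (dK 1)).mul (hasDerivAt_coord x 1 1))))
  have hcomm : pderiv 1 p x = pderiv 0 q x := pderiv_comm hψ 1 0 x
  rw [h₀, h₁, lap_eq_pderiv hψ, normSq_eq]
  simp only [hκ, hcomm, eulerDeriv, gradSq, ← hp, ← hq, zero_smul, add_zero, Pi.mul_apply,
    Pi.sub_apply, Pi.pow_apply, if_true, one_ne_zero, zero_ne_one, if_false]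
  push_cast
  ring

theorem contDiff_log_one_add_normSq {k : WithTop ℕ∞} :
    ContDiff ℝ k fun x : R2 => log (1 + ‖x‖ ^ 2) :=
  (contDiff_const.add (contDiff_norm_sq ℝ)).log fun x => by positivity

theorem pderiv_add_log {ψ : R2 → ℝ} (hψ : ContDiff ℝ 1 ψ) (β : ℝ) (i : Fin 2) (x : R2) :
    pderiv i (fun y => ψ y + β * log (1 + ‖y‖ ^ 2)) x =
      pderiv i ψ x + 2 * β / (1 + ‖x‖ ^ 2) * x i := by
  have hl : ContDiff ℝ 1 fun x : R2 => log (1 + ‖x‖ ^ 2) := contDiff_log_one_add_normSq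
  have h0 : (1 + ‖x‖ ^ 2) ≠ 0 := by positivity
  refine pderiv_eq ((hψ.add (contDiff_const.mul hl)).differentiable (by norm_num) x)
    (((hasDerivAt_pderiv (hψ.differentiable (by norm_num) x) i).add
      ((hasDerivAt_pderiv (hl.differentiable (by norm_num) x) i).const_mul β)).congr_deriv ?_)
  rw [pderiv_comp_normSq (v := fun s => log (1 + s))
    (((hasDerivAt_id (‖x‖ ^ 2)).const_add 1).log h0) i]
  simp only [id_eq]
  ring

theorem lap_add_log {ψ : R2 → ℝ} (hψ : ContDiff ℝ 2 ψ) (β : ℝ) (x : R2) :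
    lap (fun y => ψ y + β * log (1 + ‖y‖ ^ 2)) x =
      lap ψ x + 4 * β / (1 + ‖x‖ ^ 2) ^ 2 := by
  have hl : ContDiff ℝ 2 fun x : R2 => log (1 + ‖x‖ ^ 2) := contDiff_log_one_add_normSq
  have h0 : ∀ s : ℝ, 0 < s + 1 → HasDerivAt (fun s => β * log (1 + s)) (β / (1 + s)) s :=
    fun s hs => ((((hasDerivAt_id s).const_add 1).log (by simp only [id_eq]; linarith)).const_mul
      β).congr_deriv (by simp only [id_eq]; ring)
  have h1 : lap (fun y : R2 => β * log (1 + ‖y‖ ^ 2)) x = 4 * β / (1 + ‖x‖ ^ 2) ^ 2 := by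
    have hx : (1 + ‖x‖ ^ 2) ≠ 0 := by positivity
    have hev : ∀ᶠ s in nhds (‖x‖ ^ 2), 0 < s + 1 :=
      lt_mem_nhds (show -1 < ‖x‖ ^ 2 by nlinarith [sq_nonneg ‖x‖]) |>.mono fun s hs => by linarith
    rw [lap_of_eventuallyEq_comp_normSq (v := fun s => β * log (1 + s))
      (v1 := fun s => β / (1 + s)) (v2 := -β / (1 + ‖x‖ ^ 2) ^ 2) (EventuallyEq.refl _ _)
      (hev.mono h0) (((hasDerivAt_const (‖x‖ ^ 2) β).div ((hasDerivAt_id (‖x‖ ^ 2)).const_add 1) hx).congr_deriv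
        (by simp))]
    field_simp
    ring
  rw [← h1]
  simp only [lap, ← Finset.sum_add_distrib]
  refine Finset.sum_congr rfl fun i _ => ?_
  have := iteratedFDeriv_add_apply (x := x) (i := 2) hψ.contDiffAt
    ((contDiff_const (c := β)).mul hl).contDiffAt
  have h2 := congrArg (fun T => T ![EuclideanSpace.single i 1, EuclideanSpace.single i 1]) this
  exact h2

/-- The quadratic form that bounds the energy in Caccioppoli's inequality, as a function of
`w` and `l = Δw`. -/
def cutoffEnergy (w l ζ : R2 → ℝ) : ℝ :=
  4 * (∫ x, w x ^ 2 * gradSq ζ x) - 2 * ∫ x, ζ x ^ 2 * (w x * l x)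

theorem pohozaev_pointwise {x0 x1 p q a b δ : ℝ} (hδ : 0 < δ) (ha : a = b * (x0 ^ 2 + x1 ^ 2)) :
    (1 - δ) / 2 * a ^ 2 ≤ (x0 * p + x1 * q) ^ 2 - (x0 ^ 2 + x1 ^ 2) * (p ^ 2 + q ^ 2) / 2 +
      (1 / (2 * δ) + 1 / 2) * ((x0 ^ 2 + x1 ^ 2) * ((p + b * x0) ^ 2 + (q + b * x1) ^ 2)) := by
  subst ha
  set P := p + b * x0 with hP
  set Q := q + b * x1 with hQ
  have e1 : p = P - b * x0 := by ring
  have e2 : q = Q - b * x1 := by ring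
  rw [e1, e2]
  have hcs : (x0 * P + x1 * Q) ^ 2 ≤ (x0 ^ 2 + x1 ^ 2) * (P ^ 2 + Q ^ 2) := by
    nlinarith [sq_nonneg (x0 * Q - x1 * P)]
  have h2 : 1 / (2 * δ) * (x0 * P + x1 * Q) ^ 2 ≤
      1 / (2 * δ) * ((x0 ^ 2 + x1 ^ 2) * (P ^ 2 + Q ^ 2)) := by gcongr
  have h3 : 0 ≤ 1 / (2 * δ) * ((x0 * P + x1 * Q) - δ * (b * (x0 ^ 2 + x1 ^ 2))) ^ 2 := by positivity
  have h4 : 1 / (2 * δ) * ((x0 * P + x1 * Q) - δ * (b * (x0 ^ 2 + x1 ^ 2))) ^ 2 =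
      1 / (2 * δ) * (x0 * P + x1 * Q) ^ 2 - (x0 * P + x1 * Q) * (b * (x0 ^ 2 + x1 ^ 2)) +
        δ / 2 * (b * (x0 ^ 2 + x1 ^ 2)) ^ 2 := by
    field_simp
    ring
  nlinarith [sq_nonneg (x0 * P + x1 * Q)]

set_option maxHeartbeats 1000000 in
/-- A localised Pohozaev inequality for approximate solutions of `-Δψ = K exp ψ`. -/
theorem pohozaev_inequality_of_approx {ψ χ K κ ζ Z : R2 → ℝ} {β δ M ε : ℝ} (hβ : 0 < β)
    (hδ : 0 < δ) (hM : 0 ≤ M) (hε : 0 ≤ ε)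
    (hψ : ContDiff ℝ 2 ψ) (hχ : ContDiff ℝ 1 χ) (hχs : HasCompactSupport χ)
    (hK : ContDiff ℝ 1 K) (hκc : Continuous κ) (hκ : ∀ i x, pderiv i χ x = -κ x * x i)
    (hκs : ∀ x, x ∉ tsupport χ → κ x = 0) (hζ : ContDiff ℝ 1 ζ) (hζs : HasCompactSupport ζ)
    (hZ : ContDiff ℝ 1 Z) (hZs : HasCompactSupport Z) (hχ0 : ∀ x, 0 ≤ χ x) (hκ0 : ∀ x, 0 ≤ κ x)
    (hκζ : ∀ x, κ x * ‖x‖ ^ 2 ≤ M * ζ x ^ 2) (hχZ : ∀ x, χ x * ‖x‖ ^ 2 ≤ Z x ^ 2)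
    (he : ∀ x ∈ tsupport χ, |lap ψ x + K x * exp (ψ x)| ≤ ε) :
    (1 - δ) / 2 * (∫ x, κ x * (2 * β * ‖x‖ ^ 2 / (1 + ‖x‖ ^ 2)) ^ 2) ≤
      (∫ x, exp (ψ x) * (χ x * (2 * K x + eulerDeriv K x) - κ x * ‖x‖ ^ 2 * K x)) +
      (1 / (2 * δ) + 1 / 2) * M * cutoffEnergy (fun x => ψ x + β * log (1 + ‖x‖ ^ 2))
        (fun x => lap ψ x + 4 * β / (1 + ‖x‖ ^ 2) ^ 2) ζ +
      ε * ((1 / 2 + 2 * β) * (∫ x, χ x) +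
        1 / 2 * cutoffEnergy (fun x => ψ x + β * log (1 + ‖x‖ ^ 2))
          (fun x => lap ψ x + 4 * β / (1 + ‖x‖ ^ 2) ^ 2) Z) := by
  set w : R2 → ℝ := fun x => ψ x + β * log (1 + ‖x‖ ^ 2) with hw
  set C := 1 / (2 * δ) + 1 / 2 with hC
  have hCpos : 0 < C := by positivity
  have hψ1 : ContDiff ℝ 1 ψ := hψ.of_le (by norm_num)
  have hw2 : ContDiff ℝ 2 w := hψ.add (contDiff_const.mul contDiff_log_one_add_normSq)
  have hw1 : ContDiff ℝ 1 w := hw2.of_le (by norm_num)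
  have hlw : (fun x => lap ψ x + 4 * β / (1 + ‖x‖ ^ 2) ^ 2) = lap w :=
    funext fun x => (lap_add_log hψ β x).symm
  rw [hlw]
  have cζ := integral_sq_mul_gradSq_le hw2 hζ hζs
  have cZ := integral_sq_mul_gradSq_le hw2 hZ hZs
  have hpos : ∀ x : R2, (1 + ‖x‖ ^ 2) ≠ 0 := fun x => by positivity
  have c1 := hψ.continuous
  have c2 := hχ.continuous
  have c3 := hK.continuous
  have c4 := hζ.continuous
  have c5 := hZ.continuous
  have c6 := continuous_gradSq hw1
  have c7 := continuous_lap hψ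
  have c8 := continuous_eulerDeriv hψ1
  have c9 := continuous_gradSq hψ1
  have c10 := continuous_eulerDeriv hK
  have hχ' : ∀ x, x ∉ tsupport χ → χ x = 0 := fun x hx => image_eq_zero_of_notMem_tsupport hx
  have iA : Integrable fun x : R2 => κ x * (2 * β * ‖x‖ ^ 2 / (1 + ‖x‖ ^ 2)) ^ 2 :=
    integrable_of_tsupport hχs (by fun_prop (disch := assumption)) fun x hx => by simp [hκs x hx]
  have iD : Integrable fun x => exp (ψ x) * (χ x * (2 * K x + eulerDeriv K x) -
      κ x * ‖x‖ ^ 2 * K x) :=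
    integrable_of_tsupport hχs (by fun_prop) fun x hx => by simp [hκs x hx, hχ' x hx]
  have iχ : Integrable χ := c2.integrable_of_hasCompactSupport hχs
  have iζ : Integrable fun x => ζ x ^ 2 * gradSq w x :=
    integrable_of_tsupport hζs (by fun_prop) fun x hx => by
      simp [image_eq_zero_of_notMem_tsupport hx]
  have iZ : Integrable fun x => Z x ^ 2 * gradSq w x :=
    integrable_of_tsupport hZs (by fun_prop) fun x hx => by
      simp [image_eq_zero_of_notMem_tsupport hx]
  have iP : Integrable fun x => exp (ψ x) * (χ x * (2 * K x + eulerDeriv K x) -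
      κ x * ‖x‖ ^ 2 * K x) + χ x * (lap ψ x + K x * exp (ψ x)) * eulerDeriv ψ x -
      κ x * (eulerDeriv ψ x ^ 2 - ‖x‖ ^ 2 * gradSq ψ x / 2) :=
    integrable_of_tsupport hχs (by fun_prop) fun x hx => by simp [hκs x hx, hχ' x hx]
  have key : ∀ x, (1 - δ) / 2 * (κ x * (2 * β * ‖x‖ ^ 2 / (1 + ‖x‖ ^ 2)) ^ 2) +
      (exp (ψ x) * (χ x * (2 * K x + eulerDeriv K x) -
      κ x * ‖x‖ ^ 2 * K x) + χ x * (lap ψ x + K x * exp (ψ x)) * eulerDeriv ψ x -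
      κ x * (eulerDeriv ψ x ^ 2 - ‖x‖ ^ 2 * gradSq ψ x / 2)) ≤
      exp (ψ x) * (χ x * (2 * K x + eulerDeriv K x) - κ x * ‖x‖ ^ 2 * K x) +
      C * M * (ζ x ^ 2 * gradSq w x) + ε * ((1 / 2 + 2 * β) * χ x +
        1 / 2 * (Z x ^ 2 * gradSq w x)) := by
    intro x
    have hG0 : 0 ≤ gradSq w x := by unfold gradSq; positivity
    have hwp : ∀ i, pderiv i w x = pderiv i ψ x + 2 * β / (1 + ‖x‖ ^ 2) * x i := fun i =>
      pderiv_add_log hψ1 β i x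
    have h1 := pohozaev_pointwise (x0 := x 0) (x1 := x 1) (p := pderiv 0 ψ x)
      (q := pderiv 1 ψ x) (a := 2 * β * ‖x‖ ^ 2 / (1 + ‖x‖ ^ 2)) (b := 2 * β / (1 + ‖x‖ ^ 2)) hδ
      (by rw [← normSq_eq]; ring)
    rw [← normSq_eq, ← hwp, ← hwp, ← hC] at h1
    have h2 := mul_le_mul_of_nonneg_left h1 (hκ0 x)
    have h3 : C * (κ x * ‖x‖ ^ 2 * gradSq w x) ≤ C * (M * ζ x ^ 2 * gradSq w x) :=
      mul_le_mul_of_nonneg_left (mul_le_mul_of_nonneg_right (hκζ x) hG0) hCpos.le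
    have h4 : χ x * (lap ψ x + K x * exp (ψ x)) * eulerDeriv ψ x ≤
        ε * ((1 / 2 + 2 * β) * χ x + 1 / 2 * (Z x ^ 2 * gradSq w x)) := by
      by_cases hx : x ∈ tsupport χ
      · have hE : eulerDeriv ψ x = eulerDeriv w x - 2 * β * (‖x‖ ^ 2 / (1 + ‖x‖ ^ 2)) := by
          simp only [eulerDeriv, hwp]
          rw [normSq_eq]
          ring
        have hf1 : ‖x‖ ^ 2 / (1 + ‖x‖ ^ 2) ≤ 1 := by
          rw [div_le_one (by positivity)]; linarith
        have hf0 : 0 ≤ ‖x‖ ^ 2 / (1 + ‖x‖ ^ 2) := by positivity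
        have hcs : eulerDeriv w x ^ 2 ≤ ‖x‖ ^ 2 * gradSq w x := by
          rw [normSq_eq]
          unfold eulerDeriv gradSq
          nlinarith [sq_nonneg (x 0 * pderiv 1 w x - x 1 * pderiv 0 w x)]
        have hab : |eulerDeriv ψ x| ≤ 1 / 2 + 2 * β + 1 / 2 * (‖x‖ ^ 2 * gradSq w x) := by
          rw [hE, abs_le]
          constructor <;> nlinarith [sq_nonneg (eulerDeriv w x - 1), sq_nonneg (eulerDeriv w x + 1)]
        have h5 : (lap ψ x + K x * exp (ψ x)) * eulerDeriv ψ x ≤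
            ε * (1 / 2 + 2 * β + 1 / 2 * (‖x‖ ^ 2 * gradSq w x)) := by
          refine (le_abs_self _).trans ?_
          rw [abs_mul]
          exact mul_le_mul (he x hx) hab (abs_nonneg _) hε
        have h6 := mul_le_mul_of_nonneg_left h5 (hχ0 x)
        have h7 : ε * (1 / 2 * (χ x * ‖x‖ ^ 2 * gradSq w x)) ≤
            ε * (1 / 2 * (Z x ^ 2 * gradSq w x)) :=
          mul_le_mul_of_nonneg_left (mul_le_mul_of_nonneg_left
            (mul_le_mul_of_nonneg_right (hχZ x) hG0) (by norm_num)) hε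
        linarith
      · rw [hχ' x hx]
        have : 0 ≤ ε * (1 / 2 * (Z x ^ 2 * gradSq w x)) := by positivity
        linarith
    have e1 : eulerDeriv ψ x = x 0 * pderiv 0 ψ x + x 1 * pderiv 1 ψ x := rfl
    have e2 : gradSq ψ x = pderiv 0 ψ x ^ 2 + pderiv 1 ψ x ^ 2 := rfl
    have e3 : gradSq w x = pderiv 0 w x ^ 2 + pderiv 1 w x ^ 2 := rfl
    rw [← e1, ← e2, ← e3] at h2
    linarith
  have hInt := integral_mono ((iA.const_mul ((1 - δ) / 2)).add iP)
    ((iD.add (iζ.const_mul (C * M))).add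
      (((iχ.const_mul (1 / 2 + 2 * β)).add (iZ.const_mul (1 / 2))).const_mul ε)) key
  rw [integral_add' (iA.const_mul _) iP, pohozaev hψ hχ hχs hK hκ,
    integral_add' (iD.add (iζ.const_mul _))
      (((iχ.const_mul (1 / 2 + 2 * β)).add (iZ.const_mul (1 / 2))).const_mul ε),
    integral_add' iD (iζ.const_mul _), integral_const_mul, integral_const_mul, integral_const_mul,
    integral_add' (iχ.const_mul _) (iZ.const_mul _), integral_const_mul, integral_const_mul] at hInt
  have h8 : C * M * (∫ x, ζ x ^ 2 * gradSq w x) ≤ C * M * cutoffEnergy w (lap w) ζ :=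
    mul_le_mul_of_nonneg_left cζ (by positivity)
  have h9 : ε * (1 / 2 * ∫ x, Z x ^ 2 * gradSq w x) ≤ ε * (1 / 2 * cutoffEnergy w (lap w) Z) :=
    mul_le_mul_of_nonneg_left (mul_le_mul_of_nonneg_left cZ (by norm_num)) hε
  linarith

theorem tendsto_integral_comp {F : R2 → ℝ → ℝ → ℝ} {R M : ℝ} {u v : ℕ → R2 → ℝ} {U V : R2 → ℝ}
    (hF : Continuous fun p : R2 × ℝ × ℝ => F p.1 p.2.1 p.2.2)
    (hF0 : ∀ x, R < ‖x‖ → ∀ a b, F x a b = 0) (hu : ∀ k, Continuous (u k))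
    (hv : ∀ k, Continuous (v k)) (huM : ∀ k x, ‖x‖ ≤ R → |u k x| ≤ M)
    (hvM : ∀ k x, ‖x‖ ≤ R → |v k x| ≤ M)
    (hut : ∀ x, ‖x‖ ≤ R → Tendsto (fun k => u k x) atTop (nhds (U x)))
    (hvt : ∀ x, ‖x‖ ≤ R → Tendsto (fun k => v k x) atTop (nhds (V x))) :
    Tendsto (fun k => ∫ x, F x (u k x) (v k x)) atTop (nhds (∫ x, F x (U x) (V x))) := by
  obtain ⟨c, hc⟩ := ((isCompact_closedBall (0 : R2) R).prod
    ((isCompact_Icc (a := -M) (b := M)).prod (isCompact_Icc (a := -M) (b := M)))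
    ).exists_bound_of_continuousOn hF.continuousOn
  refine tendsto_integral_of_dominated_convergence
    ((closedBall (0 : R2) R).indicator fun _ => c)
    (fun k => (hF.comp (continuous_id.prodMk ((hu k).prodMk (hv k)))).aestronglyMeasurable) ?_ ?_ ?_
  · exact (integrable_indicator_iff measurableSet_closedBall).2
      (integrableOn_const measure_closedBall_lt_top.ne)
  · refine fun k => Eventually.of_forall fun x => ?_
    by_cases hx : ‖x‖ ≤ R
    · have hx' : x ∈ closedBall (0 : R2) R := by simpa using hx
      rw [Set.indicator_of_mem hx']
      exact hc (x, u k x, v k x) ⟨hx', abs_le.1 (huM k x hx), abs_le.1 (hvM k x hx)⟩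
    · have hx' : x ∉ closedBall (0 : R2) R := by simpa using hx
      rw [Set.indicator_of_notMem hx', hF0 x (not_le.1 hx), norm_zero]
  · refine Eventually.of_forall fun x => ?_
    by_cases hx : ‖x‖ ≤ R
    · exact (hF.tendsto (x, U x, V x)).comp (tendsto_const_nhds.prodMk_nhds
        ((hut x hx).prodMk_nhds (hvt x hx)))
    · simp only [hF0 x (not_le.1 hx)]
      exact tendsto_const_nhds

theorem tendsto_cutoffEnergy {β R M : ℝ} {u v : ℕ → R2 → ℝ} {U V ζ : R2 → ℝ}
    (hζ : ContDiff ℝ 1 ζ) (hζR : tsupport ζ ⊆ closedBall 0 R) (hu : ∀ k, Continuous (u k))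
    (hv : ∀ k, Continuous (v k)) (huM : ∀ k x, ‖x‖ ≤ R → |u k x| ≤ M)
    (hvM : ∀ k x, ‖x‖ ≤ R → |v k x| ≤ M)
    (hut : ∀ x, ‖x‖ ≤ R → Tendsto (fun k => u k x) atTop (nhds (U x)))
    (hvt : ∀ x, ‖x‖ ≤ R → Tendsto (fun k => v k x) atTop (nhds (V x))) :
    Tendsto (fun k => cutoffEnergy (fun x => u k x + β * log (1 + ‖x‖ ^ 2))
        (fun x => v k x + 4 * β / (1 + ‖x‖ ^ 2) ^ 2) ζ) atTop
      (nhds (cutoffEnergy (fun x => U x + β * log (1 + ‖x‖ ^ 2))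
        (fun x => V x + 4 * β / (1 + ‖x‖ ^ 2) ^ 2) ζ)) := by
  have hout : ∀ x : R2, R < ‖x‖ → x ∉ tsupport ζ := fun x hx h => by
    have := hζR h
    simp only [mem_closedBall, dist_zero_right] at this
    linarith
  have c1 := hζ.continuous
  have c2 := continuous_gradSq hζ
  have c3 : Continuous fun x : R2 => log (1 + ‖x‖ ^ 2) :=
    (contDiff_log_one_add_normSq (k := 0)).continuous
  have c4 : Continuous fun x : R2 => 4 * β / (1 + ‖x‖ ^ 2) ^ 2 := by
    have : ∀ x : R2, (1 + ‖x‖ ^ 2) ^ 2 ≠ 0 := fun x => by positivity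
    fun_prop (disch := assumption)
  refine Tendsto.sub (Tendsto.const_mul _ ?_) (Tendsto.const_mul _ ?_)
  · refine tendsto_integral_comp (F := fun x a _ => (a + β * log (1 + ‖x‖ ^ 2)) ^ 2 * gradSq ζ x)
      ?_ (fun x hx a b => by simp [gradSq_eq_zero_of_notMem (hout x hx)]) hu hv huM hvM hut hvt
    exact (((continuous_fst.comp continuous_snd).add (continuous_const.mul
      (c3.comp continuous_fst))).pow 2).mul (c2.comp continuous_fst)
  · refine tendsto_integral_comp (F := fun x a b => ζ x ^ 2 * ((a + β * log (1 + ‖x‖ ^ 2)) *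
      (b + 4 * β / (1 + ‖x‖ ^ 2) ^ 2))) ?_ (fun x hx a b => by
        simp [image_eq_zero_of_notMem_tsupport (hout x hx)]) hu hv huM hvM hut hvt
    exact ((c1.comp continuous_fst).pow 2).mul (((continuous_fst.comp continuous_snd).add
      (continuous_const.mul (c3.comp continuous_fst))).mul
      ((continuous_snd.comp continuous_snd).add (c4.comp continuous_fst)))

theorem exists_cutoff_sq_ge {f : R2 → ℝ} (hf : Continuous f) (hs : HasCompactSupport f) :
    ∃ Z : R2 → ℝ, ContDiff ℝ 1 Z ∧ HasCompactSupport Z ∧ ∀ x, f x ≤ Z x ^ 2 := by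
  obtain ⟨C, hC⟩ := hs.exists_bound_of_continuous hf
  have hC0 : 0 ≤ C := (norm_nonneg _).trans (hC 0)
  obtain ⟨r, hr0, hr⟩ := hs.isCompact.isBounded.subset_closedBall_lt 0 0
  let b : ContDiffBump (0 : R2) := ⟨r, r + 1, hr0, by linarith⟩
  refine ⟨fun x => (C + 1) * b x, contDiff_const.mul b.contDiff, b.hasCompactSupport.mul_left,
    fun x => ?_⟩
  by_cases hx : x ∈ tsupport f
  · simp only [b.one_of_mem_closedBall (hr hx)]
    nlinarith [(le_abs_self _).trans (hC x)]
  · rw [image_eq_zero_of_notMem_tsupport hx]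
    exact sq_nonneg _

/-- A localised Pohozaev inequality for continuous weak solutions of `-Δψ = K exp ψ`. -/
theorem pohozaev_inequality {ψ χ K κ ζ : R2 → ℝ} {β δ M : ℝ} (hβ : 0 < β)
    (hδ : 0 < δ) (hM : 0 ≤ M) (hψ : Continuous ψ) (hw : IsWeakSol ψ fun x => K x * exp (ψ x))
    (hχ : ContDiff ℝ 1 χ) (hχs : HasCompactSupport χ) (hK : ContDiff ℝ 1 K)
    (hκc : Continuous κ) (hκ : ∀ i x, pderiv i χ x = -κ x * x i)
    (hκs : ∀ x, x ∉ tsupport χ → κ x = 0) (hζ : ContDiff ℝ 1 ζ) (hζs : HasCompactSupport ζ)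
    (hχ0 : ∀ x, 0 ≤ χ x) (hκ0 : ∀ x, 0 ≤ κ x) (hκζ : ∀ x, κ x * ‖x‖ ^ 2 ≤ M * ζ x ^ 2) :
    (1 - δ) / 2 * (∫ x, κ x * (2 * β * ‖x‖ ^ 2 / (1 + ‖x‖ ^ 2)) ^ 2) ≤
      (∫ x, exp (ψ x) * (χ x * (2 * K x + eulerDeriv K x) - κ x * ‖x‖ ^ 2 * K x)) +
      (1 / (2 * δ) + 1 / 2) * M * cutoffEnergy (fun x => ψ x + β * log (1 + ‖x‖ ^ 2))
        (fun x => -(K x * exp (ψ x)) + 4 * β / (1 + ‖x‖ ^ 2) ^ 2) ζ := by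
  have cχ := hχ.continuous
  have cK := hK.continuous
  have cE := continuous_eulerDeriv hK
  have cg : Continuous fun x => K x * exp (ψ x) := by fun_prop
  obtain ⟨Z, hZ, hZs, hχZ⟩ := exists_cutoff_sq_ge (f := fun x => χ x * ‖x‖ ^ 2) (by fun_prop)
    (HasCompactSupport.intro hχs fun x hx => by simp [image_eq_zero_of_notMem_tsupport hx])
  obtain ⟨R, -, hR⟩ := ((hχs.isCompact.isBounded.union hζs.isCompact.isBounded).union
    hZs.isCompact.isBounded).subset_closedBall_lt 0 0
  have hχR : tsupport χ ⊆ closedBall 0 R := fun x hx => hR (Or.inl (Or.inl hx))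
  have hζR : tsupport ζ ⊆ closedBall 0 R := fun x hx => hR (Or.inl (Or.inr hx))
  have hZR : tsupport Z ⊆ closedBall 0 R := fun x hx => hR (Or.inr hx)
  obtain ⟨A, hA⟩ := (isCompact_closedBall (0 : R2) R).exists_bound_of_continuousOn
    hψ.continuousOn
  obtain ⟨G, hG⟩ := (isCompact_closedBall (0 : R2) R).exists_bound_of_continuousOn
    cg.continuousOn
  simp only [mem_closedBall, dist_zero_right, Real.norm_eq_abs] at hA hG
  choose Ψ h1 h2 h3 using fun k : ℕ =>
    exists_mollification hψ cg hw R (Nat.one_div_pos_of_nat (α := ℝ) (n := k))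
  have hk1 : ∀ k : ℕ, 1 / ((k : ℝ) + 1) ≤ 1 := fun k => by
    rw [div_le_one (by positivity)]
    have : (0 : ℝ) ≤ k := by positivity
    linarith
  have hΨ2 : ∀ k, ContDiff ℝ 2 (Ψ k) := fun k => contDiff_infty.1 (h1 k) 2
  have hu : ∀ k, Continuous (Ψ k) := fun k => (h1 k).continuous
  have hv : ∀ k, Continuous (lap (Ψ k)) := fun k => continuous_lap (hΨ2 k)
  have huM : ∀ k x, ‖x‖ ≤ R → |Ψ k x| ≤ |A| + |G| + 1 := fun k x hx => by
    have e1 := abs_le.1 ((h2 k x hx).trans (hk1 k))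
    have e2 := abs_le.1 (hA x hx)
    have e3 := le_abs_self A
    have e4 := abs_nonneg G
    rw [abs_le]
    constructor <;> linarith
  have hvM : ∀ k x, ‖x‖ ≤ R → |lap (Ψ k) x| ≤ |A| + |G| + 1 := fun k x hx => by
    have e1 := abs_le.1 ((h3 k x hx).trans (hk1 k))
    have e2 := abs_le.1 (hG x hx)
    have e3 := le_abs_self G
    have e4 := abs_nonneg A
    rw [abs_le]
    constructor <;> linarith
  have hut : ∀ x, ‖x‖ ≤ R → Tendsto (fun k => Ψ k x) atTop (nhds (ψ x)) := fun x hx => by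
    rw [tendsto_iff_dist_tendsto_zero]
    exact squeeze_zero (fun k => dist_nonneg) (fun k => h2 k x hx)
      tendsto_one_div_add_atTop_nhds_zero_nat
  have hvt : ∀ x, ‖x‖ ≤ R → Tendsto (fun k => lap (Ψ k) x) atTop
      (nhds (-(K x * exp (ψ x)))) := fun x hx => by
    rw [tendsto_iff_dist_tendsto_zero]
    refine squeeze_zero (fun k => dist_nonneg) (fun k => ?_)
      tendsto_one_div_add_atTop_nhds_zero_nat
    rw [Real.dist_eq, sub_neg_eq_add]
    exact h3 k x hx
  have he : ∀ k, ∀ x ∈ tsupport χ, |lap (Ψ k) x + K x * exp (Ψ k x)| ≤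
      (1 + 2 * |G|) * (1 / ((k : ℝ) + 1)) := by
    intro k x hx
    have hxR : ‖x‖ ≤ R := by simpa using hχR hx
    have e1 : K x * exp (Ψ k x) =
        K x * exp (ψ x) + K x * exp (ψ x) * (exp (Ψ k x - ψ x) - 1) := by
      rw [exp_sub]
      field_simp
      ring
    have e2 : |K x * exp (ψ x) * (exp (Ψ k x - ψ x) - 1)| ≤ |G| * (2 * (1 / ((k : ℝ) + 1))) := by
      rw [abs_mul]
      refine mul_le_mul ((hG x hxR).trans (le_abs_self G)) ?_ (abs_nonneg _) (abs_nonneg _)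
      exact (Real.abs_exp_sub_one_le ((h2 k x hxR).trans (hk1 k))).trans
        (mul_le_mul_of_nonneg_left (h2 k x hxR) (by norm_num))
    rw [e1, ← add_assoc]
    refine (abs_add_le _ _).trans ((add_le_add (h3 k x hxR) e2).trans (le_of_eq (by ring)))
  have hDs : ∀ x : R2, R < ‖x‖ → ∀ a b : ℝ, exp a * (χ x * (2 * K x + eulerDeriv K x) -
      κ x * ‖x‖ ^ 2 * K x) = 0 := fun x hx a b => by
    have hx' : x ∉ tsupport χ := fun h => by
      have := hχR h
      simp only [mem_closedBall, dist_zero_right] at this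
      linarith
    simp [hκs x hx', image_eq_zero_of_notMem_tsupport hx']
  have t1 := tendsto_integral_comp (F := fun x a _ => exp a * (χ x * (2 * K x + eulerDeriv K x) -
    κ x * ‖x‖ ^ 2 * K x)) (by fun_prop) hDs hu hv huM hvM hut hvt
  have t2 := tendsto_cutoffEnergy (β := β) hζ hζR hu hv huM hvM hut hvt
  have t3 := tendsto_cutoffEnergy (β := β) hZ hZR hu hv huM hvM hut hvt
  have t4 : Tendsto (fun k : ℕ => (1 + 2 * |G|) * (1 / ((k : ℝ) + 1))) atTop (nhds 0) := by
    simpa using tendsto_one_div_add_atTop_nhds_zero_nat.const_mul (1 + 2 * |G|)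
  have hlim := (t1.add (t2.const_mul ((1 / (2 * δ) + 1 / 2) * M))).add
    (t4.mul ((t3.const_mul (1 / 2)).const_add ((1 / 2 + 2 * β) * ∫ x, χ x)))
  rw [zero_mul, add_zero] at hlim
  exact ge_of_tendsto' hlim fun k => pohozaev_inequality_of_approx hβ hδ hM (by positivity)
    (hΨ2 k) hχ hχs hK hκc hκ hκs hζ hζs hZ hZs hχ0 hκ0 hκζ hχZ (he k)

/-- A smooth antitone function which is `1` on `(-∞, 1]` and `0` on `[2, ∞)`. -/
def stepDown (t : ℝ) : ℝ := smoothTransition (2 - t)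

theorem contDiff_stepDown {k : ℕ∞} : ContDiff ℝ k stepDown :=
  smoothTransition.contDiff.comp (contDiff_const.sub contDiff_id)

theorem antitone_stepDown : Antitone stepDown := fun _ _ h =>
  smoothTransition.monotone (by linarith)

theorem stepDown_nonneg (t : ℝ) : 0 ≤ stepDown t := smoothTransition.nonneg _

theorem stepDown_le_one (t : ℝ) : stepDown t ≤ 1 := smoothTransition.le_one _

theorem stepDown_of_le_one {t : ℝ} (ht : t ≤ 1) : stepDown t = 1 :=
  smoothTransition.one_of_one_le (by linarith)

theorem stepDown_eq_zero_iff {t : ℝ} : stepDown t = 0 ↔ 2 ≤ t :=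
  smoothTransition.zero_iff_nonpos.trans sub_nonpos

theorem hasDerivAt_stepDown (t : ℝ) : HasDerivAt stepDown (deriv stepDown t) t :=
  ((contDiff_stepDown (k := 1)).differentiable (by norm_num) t).hasDerivAt

theorem continuous_deriv_stepDown : Continuous (deriv stepDown) :=
  (contDiff_stepDown (k := 1)).continuous_deriv le_rfl

theorem deriv_stepDown_nonpos (t : ℝ) : deriv stepDown t ≤ 0 := antitone_stepDown.deriv_nonpos

theorem deriv_stepDown_of_le_one {t : ℝ} (ht : t ≤ 1) : deriv stepDown t = 0 := by
  have hc : IsClosed {t | deriv stepDown t = 0} :=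
    isClosed_eq continuous_deriv_stepDown continuous_const
  have hsub : Set.Iio 1 ⊆ {t | deriv stepDown t = 0} := fun s hs =>
    ((hasDerivAt_const s (1 : ℝ)).congr_of_eventuallyEq (mem_of_superset
      (Iio_mem_nhds (Set.mem_Iio.1 hs)) fun u hu => stepDown_of_le_one (le_of_lt hu))).deriv
  have := closure_minimal hsub hc
  rw [closure_Iio] at this
  exact this ht

theorem deriv_stepDown_of_two_le {t : ℝ} (ht : 2 ≤ t) : deriv stepDown t = 0 := by
  have hc : IsClosed {t | deriv stepDown t = 0} :=
    isClosed_eq continuous_deriv_stepDown continuous_const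
  have hsub : Set.Ioi 2 ⊆ {t | deriv stepDown t = 0} := fun s hs =>
    ((hasDerivAt_const s (0 : ℝ)).congr_of_eventuallyEq (mem_of_superset
      (Ioi_mem_nhds (Set.mem_Ioi.1 hs)) fun u hu => stepDown_eq_zero_iff.2 (le_of_lt hu))).deriv
  have := closure_minimal hsub hc
  rw [closure_Ioi] at this
  exact this ht

theorem exists_neg_deriv_stepDown_le : ∃ c, 0 ≤ c ∧ ∀ t, -deriv stepDown t ≤ c := by
  obtain ⟨c, hc⟩ := (HasCompactSupport.intro (isCompact_Icc (a := (1 : ℝ)) (b := 2))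
    fun t ht => by
      rcases le_or_gt t 1 with h | h
      · exact deriv_stepDown_of_le_one h
      · exact deriv_stepDown_of_two_le (not_lt.1 fun h2 => ht ⟨h.le, h2.le⟩)
    ).exists_bound_of_continuous continuous_deriv_stepDown
  exact ⟨c, (norm_nonneg _).trans (hc 0), fun t => (neg_le_abs _).trans (hc t)⟩

theorem integral_neg_deriv_stepDown : ∫ t in Set.Ioi 0, -deriv stepDown t = 1 := by
  have h := integral_Ioi_of_hasDerivAt_of_nonneg (g := fun t => -stepDown t) (a := 0) (l := 0)
    (contDiff_stepDown (k := 0)).continuous.neg.continuousWithinAt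
    (fun t _ => (hasDerivAt_stepDown t).neg)
    (fun t _ => neg_nonneg.2 (deriv_stepDown_nonpos t))
    (tendsto_const_nhds.congr' ((eventually_ge_atTop 2).mono fun t ht => by
      simp [stepDown_eq_zero_iff.2 ht]))
  rw [h, stepDown_of_le_one zero_le_one]
  norm_num

theorem integral_comp_log_div (k : ℝ → ℝ) {L : ℝ} (hL : 0 < L) :
    ∫ x : R2, k (log (1 + ‖x‖ ^ 2) / L) / (1 + ‖x‖ ^ 2) = π * (L * ∫ t in Set.Ioi 0, k t) := by
  rw [integral_comp_normSq fun s => k (log (1 + s) / L) / (1 + s)]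
  have himg : (fun s : ℝ => log (1 + s) / L) '' Set.Ioi 0 = Set.Ioi 0 := by
    ext t
    constructor
    · rintro ⟨s, hs, rfl⟩
      exact div_pos (log_pos (by linarith [Set.mem_Ioi.1 hs])) hL
    · intro ht
      refine ⟨exp (L * t) - 1, ?_, ?_⟩
      · have : 0 < L * t := mul_pos hL ht
        exact sub_pos.2 (one_lt_exp_iff.2 this)
      · simp only [add_sub_cancel, log_exp]
        field_simp
  have h := integral_image_eq_integral_abs_deriv_smul (s := Set.Ioi 0)
    (f := fun s : ℝ => log (1 + s) / L) (f' := fun s => 1 / (1 + s) / L) measurableSet_Ioi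
    (fun s hs => ((((hasDerivAt_id s).const_add 1).log (by
      simp only [id_eq]; linarith [Set.mem_Ioi.1 hs])).div_const L).hasDerivWithinAt)
    (fun s hs t ht hst => by
      have e := log_injOn_pos (show (1 + s) ∈ Set.Ioi 0 by
        simp only [Set.mem_Ioi] at *; linarith) (show (1 + t) ∈ Set.Ioi 0 by
        simp only [Set.mem_Ioi] at *; linarith) ((div_left_inj' hL.ne').1 hst)
      linarith) k
  rw [himg] at h
  congr 1
  rw [h, ← integral_const_mul]
  refine setIntegral_congr_fun measurableSet_Ioi fun s hs => ?_
  have hs' : 0 < 1 + s := by linarith [Set.mem_Ioi.1 hs]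
  simp only [smul_eq_mul]
  rw [abs_of_pos (by positivity)]
  field_simp

theorem hasCompactSupport_of_log_le {f : R2 → ℝ} {C : ℝ}
    (h : ∀ x, C < log (1 + ‖x‖ ^ 2) → f x = 0) : HasCompactSupport f := by
  refine HasCompactSupport.intro (isCompact_closedBall (0 : R2) (exp C)) fun x hx => h x ?_
  rw [lt_log_iff_exp_lt (by positivity)]
  simp only [mem_closedBall, dist_zero_right, not_le] at hx
  nlinarith [sq_nonneg (‖x‖ - 1)]

theorem log_one_add_normSq_nonneg (x : R2) : 0 ≤ log (1 + ‖x‖ ^ 2) :=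
  log_nonneg (by linarith [sq_nonneg ‖x‖])

theorem pderiv_comp_log_div {f : ℝ → ℝ} {f' L : ℝ} {x : R2}
    (hf : HasDerivAt f f' (log (1 + ‖x‖ ^ 2) / L)) (i : Fin 2) :
    pderiv i (fun y => f (log (1 + ‖y‖ ^ 2) / L)) x =
      2 * x i * (f' * (1 / (1 + ‖x‖ ^ 2) / L)) :=
  pderiv_comp_normSq (v := fun s => f (log (1 + s) / L))
    (hf.comp (‖x‖ ^ 2) ((((hasDerivAt_id (‖x‖ ^ 2)).const_add 1).log (by
      simp only [id_eq]; positivity)).div_const L)) i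

theorem gradSq_comp_log_div_le {f : ℝ → ℝ} {f' L : ℝ} {x : R2} (hL : 0 < L)
    (hf : HasDerivAt f f' (log (1 + ‖x‖ ^ 2) / L)) :
    gradSq (fun y => f (log (1 + ‖y‖ ^ 2) / L)) x ≤ 4 / L ^ 2 * (f' ^ 2 / (1 + ‖x‖ ^ 2)) := by
  have e : gradSq (fun y => f (log (1 + ‖y‖ ^ 2) / L)) x =
      4 / L ^ 2 * (f' ^ 2 / (1 + ‖x‖ ^ 2)) * (‖x‖ ^ 2 / (1 + ‖x‖ ^ 2)) := by
    simp only [gradSq, pderiv_comp_log_div hf]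
    rw [show ‖x‖ ^ 2 / (1 + ‖x‖ ^ 2) = (x 0 ^ 2 + x 1 ^ 2) / (1 + ‖x‖ ^ 2) by rw [← normSq_eq]]
    field_simp
    ring
  rw [e]
  refine mul_le_of_le_one_right (by positivity) ?_
  rw [div_le_one (by positivity)]
  linarith

theorem exists_abs_add_log_le {ψ : R2 → ℝ} {β τ : ℝ} (hβ : 0 < β) (hτ : 0 < τ)
    (hψ : Continuous ψ)
    (ht : Tendsto (fun x : R2 => ψ x / log ‖x‖) (cobounded R2) (nhds (-(2 * β)))) :
    ∃ C, 0 ≤ C ∧ ∀ x, |ψ x + β * log (1 + ‖x‖ ^ 2)| ≤ τ * log (1 + ‖x‖ ^ 2) + C := by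
  have hev := (Metric.tendsto_nhds.1 ht τ hτ).and
    ((tendsto_norm_cobounded_atTop (E := R2)).eventually_gt_atTop 1)
  obtain ⟨R, -, hR⟩ := (Metric.hasBasis_cobounded_compl_closedBall (0 : R2)).eventually_iff.1 hev
  have hc : Continuous fun x : R2 => ψ x + β * log (1 + ‖x‖ ^ 2) :=
    hψ.add (continuous_const.mul (contDiff_log_one_add_normSq (k := 0)).continuous)
  obtain ⟨C, hC⟩ := (isCompact_closedBall (0 : R2) R).exists_bound_of_continuousOn hc.continuousOn
  have h2 : 0 ≤ log 2 := log_nonneg (by norm_num)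
  refine ⟨|C| + β * log 2, by positivity, fun x => ?_⟩
  have hl := log_one_add_normSq_nonneg x
  by_cases hx : x ∈ closedBall (0 : R2) R
  · have := (hC x hx).trans (le_abs_self C)
    rw [Real.norm_eq_abs] at this
    have h3 : 0 ≤ τ * log (1 + ‖x‖ ^ 2) := by positivity
    have h4 : 0 ≤ β * log 2 := by positivity
    linarith
  · obtain ⟨h3, h4⟩ := hR hx
    have hlog : 0 < log ‖x‖ := log_pos h4
    have e2 : log (‖x‖ ^ 2) = 2 * log ‖x‖ := by rw [log_pow]; norm_num
    have hx2 : 1 ≤ ‖x‖ ^ 2 := by nlinarith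
    have h5 : 2 * log ‖x‖ ≤ log (1 + ‖x‖ ^ 2) := by
      rw [← e2]
      exact log_le_log (by positivity) (by linarith)
    have h6 : log (1 + ‖x‖ ^ 2) ≤ log 2 + 2 * log ‖x‖ := by
      rw [← e2, ← log_mul (by norm_num) (by positivity)]
      exact log_le_log (by positivity) (by linarith)
    rw [Real.dist_eq, abs_lt] at h3
    have e3 : ψ x = ψ x / log ‖x‖ * log ‖x‖ := by field_simp
    set q := ψ x / log ‖x‖ with hq
    rw [e3]
    have h7 := abs_nonneg C
    rw [abs_le]
    constructor <;> nlinarith [mul_pos hβ hlog, mul_pos hτ hlog]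

theorem integral_one_div_one_add_normSq_sq : ∫ x : R2, 1 / (1 + ‖x‖ ^ 2) ^ 2 = π := by
  have h := integral_comp_log_div (fun t => exp (-t)) one_pos
  rw [integral_exp_neg_Ioi_zero] at h
  simp only [div_one, mul_one] at h
  rw [← h]
  congr 1
  ext x
  have : 0 < 1 + ‖x‖ ^ 2 := by positivity
  rw [exp_neg, exp_log this]
  field_simp

theorem integrable_one_div_one_add_normSq_sq : Integrable fun x : R2 => 1 / (1 + ‖x‖ ^ 2) ^ 2 :=
  Integrable.of_integral_ne_zero (by
    rw [integral_one_div_one_add_normSq_sq]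
    exact pi_ne_zero)

theorem cutoffEnergy_le {w g : R2 → ℝ} {f : ℝ → ℝ} {β L T : ℝ} (hβ : 0 < β) (hL : 0 < L)
    (hT : 0 ≤ T) (hf : ContDiff ℝ 1 f) (hf0 : ∀ t, 0 ≤ f t) (hf1 : ∀ t, f t ≤ 1)
    (hfs : ∀ t, 5 / 2 ≤ t → f t = 0) (hg0 : ∀ x, 0 ≤ g x) (hg : Integrable g)
    (hwT : ∀ x, log (1 + ‖x‖ ^ 2) / L ≤ 5 / 2 → |w x| ≤ T) :
    cutoffEnergy w (fun x => -g x + 4 * β / (1 + ‖x‖ ^ 2) ^ 2)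
        (fun x => f (log (1 + ‖x‖ ^ 2) / L)) ≤
      4 * (T ^ 2 * (4 / L ^ 2 * (π * (L * ∫ t in Set.Ioi 0, deriv f t ^ 2)))) +
        2 * (T * ((∫ x, g x) + 4 * β * π)) := by
  have hd : ∀ t, HasDerivAt f (deriv f t) t := fun t =>
    (hf.differentiable (by norm_num) t).hasDerivAt
  have hdc : Continuous (deriv f) := hf.continuous_deriv le_rfl
  have hds : ∀ t, 5 / 2 < t → deriv f t = 0 := fun t ht =>
    ((hasDerivAt_const t (0 : ℝ)).congr_of_eventuallyEq (mem_of_superset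
      (Ioi_mem_nhds ht) fun u hu => hfs u (le_of_lt hu))).deriv
  have hlc : Continuous fun x : R2 => log (1 + ‖x‖ ^ 2) :=
    (contDiff_log_one_add_normSq (k := 0)).continuous
  have hpos : ∀ x : R2, 1 + ‖x‖ ^ 2 ≠ 0 := fun x => by positivity
  have i1 : Integrable fun x : R2 => T ^ 2 * (4 / L ^ 2 *
      (deriv f (log (1 + ‖x‖ ^ 2) / L) ^ 2 / (1 + ‖x‖ ^ 2))) := by
    refine Continuous.integrable_of_hasCompactSupport
      (by fun_prop (disch := assumption)) (hasCompactSupport_of_log_le (C := 5 / 2 * L)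
        fun x hx => ?_)
    rw [hds _ ((lt_div_iff₀ hL).2 hx)]
    simp
  have h1 : ∫ x, w x ^ 2 * gradSq (fun x => f (log (1 + ‖x‖ ^ 2) / L)) x ≤
      T ^ 2 * (4 / L ^ 2 * (π * (L * ∫ t in Set.Ioi 0, deriv f t ^ 2))) := by
    rw [← integral_comp_log_div _ hL, ← integral_const_mul, ← integral_const_mul]
    refine integral_mono_of_nonneg (Eventually.of_forall fun x => ?_) i1
      (Eventually.of_forall fun x => ?_)
    · simp only [Pi.zero_apply, gradSq]
      positivity
    · have hG := gradSq_comp_log_div_le hL (hd (log (1 + ‖x‖ ^ 2) / L))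
      rcases le_or_gt (log (1 + ‖x‖ ^ 2) / L) (5 / 2) with h | h
      · have h2 : w x ^ 2 ≤ T ^ 2 := sq_le_sq' (abs_le.1 (hwT x h)).1 (abs_le.1 (hwT x h)).2
        exact mul_le_mul h2 hG (by unfold gradSq; positivity) (by positivity)
      · simp only [hds _ h] at hG ⊢
        have h0 : 0 ≤ w x ^ 2 := sq_nonneg _
        norm_num at hG ⊢
        exact mul_nonpos_of_nonneg_of_nonpos h0 hG
  have i2 : Integrable fun x : R2 => T * (g x + 4 * β * (1 / (1 + ‖x‖ ^ 2) ^ 2)) :=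
    (hg.add (integrable_one_div_one_add_normSq_sq.const_mul (4 * β))).const_mul T
  have h2 := norm_integral_le_of_norm_le (f := fun x : R2 => f (log (1 + ‖x‖ ^ 2) / L) ^ 2 *
    (w x * (-g x + 4 * β / (1 + ‖x‖ ^ 2) ^ 2))) i2 (Eventually.of_forall fun x => by
      have hG : 0 ≤ g x + 4 * β * (1 / (1 + ‖x‖ ^ 2) ^ 2) := add_nonneg (hg0 x) (by positivity)
      rcases le_or_gt (log (1 + ‖x‖ ^ 2) / L) (5 / 2) with h | h
      · rw [Real.norm_eq_abs, abs_mul, abs_mul, abs_of_nonneg (sq_nonneg _)]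
        have e1 : f (log (1 + ‖x‖ ^ 2) / L) ^ 2 ≤ 1 := pow_le_one₀ (hf0 _) (hf1 _)
        have e2 : |-g x + 4 * β / (1 + ‖x‖ ^ 2) ^ 2| ≤
            g x + 4 * β * (1 / (1 + ‖x‖ ^ 2) ^ 2) := by
          have e3 : 0 ≤ 4 * β / (1 + ‖x‖ ^ 2) ^ 2 := by positivity
          rw [mul_one_div, abs_le]
          constructor <;> linarith [hg0 x]
        calc _ ≤ 1 * (T * (g x + 4 * β * (1 / (1 + ‖x‖ ^ 2) ^ 2))) :=
              mul_le_mul e1 (mul_le_mul (hwT x h) e2 (abs_nonneg _) hT) (by positivity) zero_le_one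
          _ = _ := one_mul _
      · rw [hfs _ h.le]
        simp only [ne_eq, OfNat.ofNat_ne_zero, not_false_eq_true, zero_pow, zero_mul, norm_zero]
        positivity)
  rw [integral_const_mul, integral_add hg (integrable_one_div_one_add_normSq_sq.const_mul _),
    integral_const_mul, integral_one_div_one_add_normSq_sq] at h2
  have h3 := (abs_le.1 (Real.norm_eq_abs _ ▸ h2)).1
  unfold cutoffEnergy
  linarith

theorem le_integral_deriv_stepDown {β L : ℝ} (hβ : 0 < β) (hL : 0 < L) :
    8 * π * β ^ 2 * (1 - exp (-L)) ^ 2 ≤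
      ∫ x : R2, -deriv stepDown (log (1 + ‖x‖ ^ 2) / L) * (2 / (L * (1 + ‖x‖ ^ 2))) *
        (2 * β * ‖x‖ ^ 2 / (1 + ‖x‖ ^ 2)) ^ 2 := by
  have hlc : Continuous fun x : R2 => log (1 + ‖x‖ ^ 2) :=
    (contDiff_log_one_add_normSq (k := 0)).continuous
  have hpos : ∀ x : R2, 1 + ‖x‖ ^ 2 ≠ 0 := fun x => by positivity
  have hpos' : ∀ x : R2, L * (1 + ‖x‖ ^ 2) ≠ 0 := fun x => by positivity
  have hdc := continuous_deriv_stepDown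
  have hs : ∀ x : R2, 2 * L < log (1 + ‖x‖ ^ 2) → deriv stepDown (log (1 + ‖x‖ ^ 2) / L) = 0 :=
    fun x hx => deriv_stepDown_of_two_le ((le_div_iff₀ hL).2 hx.le)
  have e : 8 * π * β ^ 2 * (1 - exp (-L)) ^ 2 = ∫ x : R2, 8 * β ^ 2 * (1 - exp (-L)) ^ 2 / L *
      (-deriv stepDown (log (1 + ‖x‖ ^ 2) / L) / (1 + ‖x‖ ^ 2)) := by
    rw [integral_const_mul, integral_comp_log_div (fun t => -deriv stepDown t) hL,
      integral_neg_deriv_stepDown]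
    field_simp
  rw [e]
  refine integral_mono (Continuous.integrable_of_hasCompactSupport
      (by fun_prop (disch := assumption)) (hasCompactSupport_of_log_le (C := 2 * L)
        fun x hx => by simp [hs x hx])) (Continuous.integrable_of_hasCompactSupport
      (by fun_prop (disch := assumption)) (hasCompactSupport_of_log_le (C := 2 * L)
        fun x hx => by simp [hs x hx])) fun x => ?_
  rcases le_or_gt (log (1 + ‖x‖ ^ 2) / L) 1 with h | h
  · simp [deriv_stepDown_of_le_one h]
  · have h1 : exp L < 1 + ‖x‖ ^ 2 := by
      rw [← lt_log_iff_exp_lt (by positivity)]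
      simpa using (lt_div_iff₀ hL).1 h
    have h2 : 1 - exp (-L) ≤ ‖x‖ ^ 2 / (1 + ‖x‖ ^ 2) := by
      have : (1 + ‖x‖ ^ 2)⁻¹ ≤ exp (-L) := by
        rw [exp_neg]
        exact inv_anti₀ (exp_pos _) h1.le
      have e3 : ‖x‖ ^ 2 / (1 + ‖x‖ ^ 2) = 1 - (1 + ‖x‖ ^ 2)⁻¹ := by
        have := hpos x
        field_simp
        ring
      linarith
    have h3 : 0 ≤ 1 - exp (-L) := by
      rw [sub_nonneg, exp_le_one_iff]
      linarith
    have h4 : (1 - exp (-L)) ^ 2 ≤ (‖x‖ ^ 2 / (1 + ‖x‖ ^ 2)) ^ 2 := pow_le_pow_left₀ h3 h2 2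
    have h5 : 0 ≤ -deriv stepDown (log (1 + ‖x‖ ^ 2) / L) := neg_nonneg.2 (deriv_stepDown_nonpos _)
    have h6 : 0 ≤ -deriv stepDown (log (1 + ‖x‖ ^ 2) / L) * (2 / (L * (1 + ‖x‖ ^ 2))) *
        (4 * β ^ 2) := by positivity
    calc _ = -deriv stepDown (log (1 + ‖x‖ ^ 2) / L) * (2 / (L * (1 + ‖x‖ ^ 2))) *
          (4 * β ^ 2) * (1 - exp (-L)) ^ 2 := by
          field_simp
          ring
      _ ≤ _ := mul_le_mul_of_nonneg_left h4 h6
      _ = _ := by ring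

theorem contDiff_landau_weight {k : WithTop ℕ∞} (B β : ℝ) (n : ℕ) : ContDiff ℝ k fun x : R2 =>
    4 * π * β * ‖x‖ ^ (2 * n) * exp (-B * ‖x‖ ^ 2 / 2) := by
  have h : ContDiff ℝ k fun x : R2 => ‖x‖ ^ 2 := contDiff_norm_sq ℝ
  simp only [pow_mul]
  fun_prop

theorem eulerDeriv_landau_weight (B β : ℝ) (n : ℕ) (x : R2) :
    eulerDeriv (fun x : R2 => 4 * π * β * ‖x‖ ^ (2 * n) * exp (-B * ‖x‖ ^ 2 / 2)) x =
      (2 * n - B * ‖x‖ ^ 2) * (4 * π * β * ‖x‖ ^ (2 * n) * exp (-B * ‖x‖ ^ 2 / 2)) := by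
  have hv : ∀ s : ℝ, HasDerivAt (fun s => 4 * π * β * s ^ n * exp (-B * s / 2))
      (4 * π * β * (n * s ^ (n - 1) - s ^ n * (B / 2)) * exp (-B * s / 2)) s := fun s => by
    refine (((hasDerivAt_pow n s).const_mul (4 * π * β)).mul
      (((hasDerivAt_id s).const_mul (-B)).div_const 2).exp).congr_deriv ?_
    simp only [id_eq]
    ring
  simp only [pow_mul, eulerDeriv, pderiv_comp_normSq (hv _)]
  have e : (n : ℝ) * (‖x‖ ^ 2) ^ n = n * (‖x‖ ^ 2) ^ (n - 1) * ‖x‖ ^ 2 := by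
    rcases n with _ | n
    · simp
    · rw [Nat.add_sub_cancel, pow_succ]
      ring
  have e2 : x 0 * (2 * x 0 * (4 * π * β * (n * (‖x‖ ^ 2) ^ (n - 1) - (‖x‖ ^ 2) ^ n * (B / 2)) *
      exp (-B * ‖x‖ ^ 2 / 2))) + x 1 * (2 * x 1 * (4 * π * β * (n * (‖x‖ ^ 2) ^ (n - 1) -
      (‖x‖ ^ 2) ^ n * (B / 2)) * exp (-B * ‖x‖ ^ 2 / 2))) = 2 * (x 0 ^ 2 + x 1 ^ 2) *
      (4 * π * β * (n * (‖x‖ ^ 2) ^ (n - 1) - (‖x‖ ^ 2) ^ n * (B / 2)) *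
      exp (-B * ‖x‖ ^ 2 / 2)) := by ring
  rw [e2, ← normSq_eq]
  linear_combination (-(8 * π * β * exp (-B * ‖x‖ ^ 2 / 2))) * e

/-- The localised Pohozaev inequality for the logarithmic cutoff at scale `L`, with a deficit
given by the part of the second moment inside a fixed ball. -/
theorem landau_level_inequality {ψ : R2 → ℝ} {B β δ c L T : ℝ} {n : ℕ} {f : ℝ → ℝ} (hB : 0 < B)
    (hβ : 0 < β) (hδ : 0 < δ) (hδ1 : δ ≤ 1) (hc0 : 0 ≤ c) (hc : ∀ t, -deriv stepDown t ≤ c)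
    (hL : 1 ≤ L) (hT : 0 ≤ T)
    (hf : ContDiff ℝ 1 f) (hf0 : ∀ t, 0 ≤ f t) (hf1 : ∀ t, f t ≤ 1)
    (hfs : ∀ t, 5 / 2 ≤ t → f t = 0) (hf12 : ∀ t, 1 ≤ t → t ≤ 2 → f t = 1)
    (hψ : Continuous ψ)
    (hw : IsWeakSol ψ fun x => 4 * π * β * ‖x‖ ^ (2 * n) * exp (-B * ‖x‖ ^ 2 / 2) * exp (ψ x))
    (hm : ∫ x : R2, ‖x‖ ^ (2 * n) * exp (-B * ‖x‖ ^ 2 / 2) * exp (ψ x) = 1)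
    (hwT : ∀ x, log (1 + ‖x‖ ^ 2) / L ≤ 5 / 2 → |ψ x + β * log (1 + ‖x‖ ^ 2)| ≤ T) :
    (1 - δ) * (4 * π * β ^ 2 * (1 - exp (-L)) ^ 2) ≤ (2 * n + 2) * (4 * π * β) -
      B * (∫ x : R2, stepDown (log (1 + ‖x‖ ^ 2)) * (‖x‖ ^ 2 *
        (4 * π * β * ‖x‖ ^ (2 * n) * exp (-B * ‖x‖ ^ 2 / 2) * exp (ψ x)))) +
      (1 / (2 * δ) + 1 / 2) * (c * 2 / L) *
        (4 * (T ^ 2 * (4 / L ^ 2 * (π * (L * ∫ t in Set.Ioi 0, deriv f t ^ 2)))) +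
        2 * (T * (4 * π * β + 4 * β * π))) := by
  have hL0 : 0 < L := by linarith
  set K : R2 → ℝ := fun x => 4 * π * β * ‖x‖ ^ (2 * n) * exp (-B * ‖x‖ ^ 2 / 2) with hK
  have hK1 : ContDiff ℝ 1 K := contDiff_landau_weight B β n
  have hKc := hK1.continuous
  have hK0 : ∀ x, 0 ≤ K x := fun x => by simp only [hK]; positivity
  have hg0 : ∀ x, 0 ≤ K x * exp (ψ x) := fun x => mul_nonneg (hK0 x) (exp_pos _).le
  have hKe : ∀ x, K x * exp (ψ x) =
      4 * π * β * (‖x‖ ^ (2 * n) * exp (-B * ‖x‖ ^ 2 / 2) * exp (ψ x)) := fun x => by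
    simp only [hK]
    ring
  have hgI : Integrable fun x => K x * exp (ψ x) := by
    simp only [hKe]
    exact (Integrable.of_integral_ne_zero (by rw [hm]; exact one_ne_zero)).const_mul _
  have hgi : ∫ x, K x * exp (ψ x) = 4 * π * β := by
    simp only [hKe]
    rw [integral_const_mul, hm, mul_one]
  set χ : R2 → ℝ := fun x => stepDown (log (1 + ‖x‖ ^ 2) / L) with hχ
  set κ : R2 → ℝ := fun x =>
    -deriv stepDown (log (1 + ‖x‖ ^ 2) / L) * (2 / (L * (1 + ‖x‖ ^ 2))) with hκ
  set ζ : R2 → ℝ := fun x => f (log (1 + ‖x‖ ^ 2) / L) with hζ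
  have hlC : ContDiff ℝ 1 fun x : R2 => log (1 + ‖x‖ ^ 2) := contDiff_log_one_add_normSq
  have hlc := hlC.continuous
  have hpos' : ∀ x : R2, L * (1 + ‖x‖ ^ 2) ≠ 0 := fun x => by positivity
  have hdc := continuous_deriv_stepDown
  have hχ1 : ContDiff ℝ 1 χ := (contDiff_stepDown (k := 1)).comp (hlC.div_const L)
  have hζ1 : ContDiff ℝ 1 ζ := hf.comp (hlC.div_const L)
  have hχc := hχ1.continuous
  have hχs : HasCompactSupport χ := hasCompactSupport_of_log_le (C := 2 * L) fun x hx =>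
    stepDown_eq_zero_iff.2 ((le_div_iff₀ hL0).2 hx.le)
  have hζs : HasCompactSupport ζ := hasCompactSupport_of_log_le (C := 5 / 2 * L) fun x hx =>
    hfs _ ((le_div_iff₀ hL0).2 hx.le)
  have hκc : Continuous κ := by fun_prop (disch := assumption)
  have hκ0 : ∀ x, 0 ≤ κ x := fun x =>
    mul_nonneg (neg_nonneg.2 (deriv_stepDown_nonpos _)) (by positivity)
  have hκs : ∀ x, x ∉ tsupport χ → κ x = 0 := fun x hx => by
    have h := stepDown_eq_zero_iff.1 (image_eq_zero_of_notMem_tsupport (f := χ) hx)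
    simp only [hκ, deriv_stepDown_of_two_le h, neg_zero, zero_mul]
  have hκχ : ∀ i x, pderiv i χ x = -κ x * x i := fun i x => by
    rw [hχ, pderiv_comp_log_div (hasDerivAt_stepDown _)]
    simp only [hκ]
    field_simp
  have hκζ : ∀ x, κ x * ‖x‖ ^ 2 ≤ c * 2 / L * ζ x ^ 2 := fun x => by
    rcases le_or_gt (log (1 + ‖x‖ ^ 2) / L) 1 with h | h
    · simp only [hκ, deriv_stepDown_of_le_one h, neg_zero, zero_mul]
      positivity
    rcases le_or_gt 2 (log (1 + ‖x‖ ^ 2) / L) with h2 | h2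
    · simp only [hκ, deriv_stepDown_of_two_le h2, neg_zero, zero_mul]
      positivity
    have e1 : ζ x = 1 := hf12 _ h.le h2.le
    have e2 : κ x * ‖x‖ ^ 2 = -deriv stepDown (log (1 + ‖x‖ ^ 2) / L) *
        (2 / L * (‖x‖ ^ 2 / (1 + ‖x‖ ^ 2))) := by
      simp only [hκ]
      field_simp
    have e3 : ‖x‖ ^ 2 / (1 + ‖x‖ ^ 2) ≤ 1 := by
      rw [div_le_one (by positivity)]
      linarith
    rw [e1, e2, one_pow, mul_one, mul_div_assoc]
    exact mul_le_mul (hc _) (mul_le_of_le_one_right (by positivity) e3) (by positivity) hc0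
  have hP := pohozaev_inequality hβ hδ (M := c * 2 / L) (by positivity) hψ hw hχ1 hχs hK1 hκc hκχ
    hκs hζ1 hζs (fun x => stepDown_nonneg _) hκ0 hκζ
  have hE := cutoffEnergy_le (g := fun x => K x * exp (ψ x)) hβ hL0 hT hf hf0 hf1 hfs hg0 hgI hwT
  rw [hgi] at hE
  have hA := mul_le_mul_of_nonneg_left (le_integral_deriv_stepDown hβ hL0)
    (show 0 ≤ (1 - δ) / 2 by linarith)
  have hχ0 : ∀ x, 0 ≤ χ x := fun x => stepDown_nonneg _
  have hcE := continuous_eulerDeriv hK1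
  have hχ' : ∀ x, x ∉ tsupport χ → χ x = 0 := fun x hx => image_eq_zero_of_notMem_tsupport hx
  have hχ₁s : HasCompactSupport fun x : R2 => stepDown (log (1 + ‖x‖ ^ 2)) :=
    hasCompactSupport_of_log_le (C := 2) fun x hx => stepDown_eq_zero_iff.2 hx.le
  have hsc : Continuous stepDown := (contDiff_stepDown (k := 0)).continuous
  have iM : Integrable fun x : R2 => stepDown (log (1 + ‖x‖ ^ 2)) * (‖x‖ ^ 2 *
      (K x * exp (ψ x))) := by
    refine integrable_of_tsupport hχ₁s (by fun_prop) fun x hx => ?_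
    have h0 : stepDown (log (1 + ‖x‖ ^ 2)) = 0 :=
      image_eq_zero_of_notMem_tsupport (f := fun x : R2 => stepDown (log (1 + ‖x‖ ^ 2))) hx
    rw [h0, zero_mul]
  have hD : ∫ x, exp (ψ x) * (χ x * (2 * K x + eulerDeriv K x) - κ x * ‖x‖ ^ 2 * K x) ≤
      (2 * n + 2) * (4 * π * β) - B * ∫ x : R2, stepDown (log (1 + ‖x‖ ^ 2)) * (‖x‖ ^ 2 *
        (K x * exp (ψ x))) := by
    rw [← hgi, ← integral_const_mul, ← integral_const_mul, ← integral_sub (hgI.const_mul _)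
      (iM.const_mul _)]
    refine integral_mono (integrable_of_tsupport hχs (by fun_prop) fun x hx => by
      simp [hκs x hx, hχ' x hx]) ((hgI.const_mul _).sub (iM.const_mul _)) fun x => ?_
    have e1 : eulerDeriv K x = (2 * n - B * ‖x‖ ^ 2) * K x := eulerDeriv_landau_weight B β n x
    simp only [e1]
    have h1 : 0 ≤ κ x * ‖x‖ ^ 2 * (K x * exp (ψ x)) :=
      mul_nonneg (mul_nonneg (hκ0 x) (sq_nonneg _)) (hg0 x)
    have h2 : χ x * ((2 * n + 2) * (K x * exp (ψ x))) ≤ (2 * n + 2) * (K x * exp (ψ x)) :=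
      mul_le_of_le_one_left (mul_nonneg (by positivity) (hg0 x)) (stepDown_le_one _)
    have h3 : stepDown (log (1 + ‖x‖ ^ 2)) ≤ χ x :=
      antitone_stepDown (div_le_self (log_one_add_normSq_nonneg x) hL)
    have h4 : stepDown (log (1 + ‖x‖ ^ 2)) * (B * (‖x‖ ^ 2 * (K x * exp (ψ x)))) ≤
        χ x * (B * (‖x‖ ^ 2 * (K x * exp (ψ x)))) :=
      mul_le_mul_of_nonneg_right h3 (mul_nonneg hB.le (mul_nonneg (sq_nonneg _) (hg0 x)))
    linarith
  have hE2 := mul_le_mul_of_nonneg_left hE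
    (show 0 ≤ (1 / (2 * δ) + 1 / 2) * (c * 2 / L) by positivity)
  have e : (1 - δ) * (4 * π * β ^ 2 * (1 - exp (-L)) ^ 2) =
    (1 - δ) / 2 * (8 * π * β ^ 2 * (1 - exp (-L)) ^ 2) := by ring
  rw [e]
  linarith

theorem lt_of_weak_solution {ψ : R2 → ℝ} {B β : ℝ} {n : ℕ} (hB : 0 < B) (hβ : 0 < β)
    (hψ : Continuous ψ)
    (hw : IsWeakSol ψ fun x => 4 * π * β * ‖x‖ ^ (2 * n) * exp (-B * ‖x‖ ^ 2 / 2) * exp (ψ x))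
    (hm : ∫ x : R2, ‖x‖ ^ (2 * n) * exp (-B * ‖x‖ ^ 2 / 2) * exp (ψ x) = 1)
    (ht : Tendsto (fun x : R2 => ψ x / log ‖x‖) (cobounded R2) (nhds (-(2 * β)))) :
    β - 2 < 2 * n := by
  obtain ⟨c, hc0, hc⟩ := exists_neg_deriv_stepDown_le
  let b : ContDiffBump (3 / 2 : ℝ) := ⟨1 / 2, 1, by norm_num, by norm_num⟩
  have hbs : ∀ t, 5 / 2 ≤ t → b t = 0 := fun t h => b.zero_of_le_dist (by
    rw [Real.dist_eq]
    exact le_trans (show (1 : ℝ) ≤ t - 3 / 2 by linarith) (le_abs_self _))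
  have hb1 : ∀ t, 1 ≤ t → t ≤ 2 → b t = 1 := fun t h1 h2 => b.one_of_mem_closedBall (by
    rw [mem_closedBall, Real.dist_eq, abs_le]
    constructor <;> linarith)
  set D := ∫ t in Set.Ioi 0, deriv b t ^ 2 with hD
  set c₀ := ∫ x : R2, stepDown (log (1 + ‖x‖ ^ 2)) * (‖x‖ ^ 2 *
        (4 * π * β * ‖x‖ ^ (2 * n) * exp (-B * ‖x‖ ^ 2 / 2) * exp (ψ x))) with hc₀
  have hpos : 0 < c₀ := by
    have hKc := (contDiff_landau_weight (k := 0) B β n).continuous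
    have hlc : Continuous fun x : R2 => log (1 + ‖x‖ ^ 2) :=
      (contDiff_log_one_add_normSq (k := 0)).continuous
    have hsc : Continuous stepDown := (contDiff_stepDown (k := 0)).continuous
    refine Continuous.integral_pos_of_hasCompactSupport_nonneg_nonzero
      (x := EuclideanSpace.single 0 1) (by fun_prop)
      (hasCompactSupport_of_log_le (C := 2) fun x hx => by
        rw [stepDown_eq_zero_iff.2 hx.le, zero_mul])
      (fun x => mul_nonneg (stepDown_nonneg _) (by positivity)) ?_
    have hs : stepDown (log (1 + 1)) ≠ 0 := by
      rw [ne_eq, stepDown_eq_zero_iff, not_le, log_lt_iff_lt_exp (by norm_num)]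
      linarith [add_one_lt_exp (show (2 : ℝ) ≠ 0 by norm_num)]
    simp only [PiLp.norm_single, norm_one, one_pow, mul_one, one_mul]
    exact mul_ne_zero hs (by positivity)
  have main : ∀ δ, 0 < δ → δ ≤ 1 →
      (1 - δ) * (4 * π * β ^ 2) ≤ (2 * n + 2) * (4 * π * β) - B * c₀ := by
    intro δ hδ hδ1
    have step : ∀ τ, 0 < τ → (1 - δ) * (4 * π * β ^ 2) ≤ (2 * n + 2) * (4 * π * β) - B * c₀ +
        (1 / (2 * δ) + 1 / 2) * (c * 2) * (144 * τ ^ 2 * (π * D) + 48 * π * β * τ) := by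
      intro τ hτ
      obtain ⟨C, hC0, hC⟩ := exists_abs_add_log_le hβ hτ hψ ht
      have hlim : Tendsto (fun L : ℝ => (1 - δ) * (4 * π * β ^ 2 * (1 - exp (-L)) ^ 2)) atTop
          (nhds ((1 - δ) * (4 * π * β ^ 2))) := by
        have := (((tendsto_exp_neg_atTop_nhds_zero.const_sub 1).pow 2).const_mul
          (4 * π * β ^ 2)).const_mul (1 - δ)
        simpa using this
      refine le_of_tendsto hlim ?_
      filter_upwards [eventually_ge_atTop 1, eventually_ge_atTop (2 * C / τ)] with L hL hLC
      have hL0 : 0 < L := by linarith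
      have hLC' : 2 * C ≤ L * τ := (div_le_iff₀ hτ).1 hLC
      have h := landau_level_inequality (T := 3 * τ * L) hB hβ hδ hδ1 hc0 hc hL (by positivity)
        b.contDiff (fun t => b.nonneg) (fun t => b.le_one) hbs hb1 hψ hw hm (fun x hx => by
          have h1 := mul_le_mul_of_nonneg_left ((div_le_iff₀ hL0).1 hx) hτ.le
          linarith [hC x])
      rw [← hD, ← hc₀] at h
      refine h.trans (le_of_eq ?_)
      field_simp
      ring
    have hlim : Tendsto (fun τ : ℝ => (2 * n + 2) * (4 * π * β) - B * c₀ +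
        (1 / (2 * δ) + 1 / 2) * (c * 2) * (144 * τ ^ 2 * (π * D) + 48 * π * β * τ))
        (nhdsWithin 0 (Set.Ioi 0)) (nhds ((2 * n + 2) * (4 * π * β) - B * c₀)) := by
      refine tendsto_nhdsWithin_of_tendsto_nhds ?_
      refine Continuous.tendsto' (by fun_prop) _ _ ?_
      ring
    exact ge_of_tendsto hlim (eventually_mem_nhdsWithin.mono step)
  have hlim : Tendsto (fun δ : ℝ => (1 - δ) * (4 * π * β ^ 2)) (nhdsWithin 0 (Set.Ioi 0))
      (nhds (4 * π * β ^ 2)) :=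
    tendsto_nhdsWithin_of_tendsto_nhds (Continuous.tendsto' (by fun_prop) _ _ (by ring))
  have hfin := le_of_tendsto hlim (eventually_mem_nhdsWithin.and
    (mem_nhdsWithin_of_mem_nhds (Iic_mem_nhds zero_lt_one)) |>.mono fun δ h => main δ h.1 h.2)
  have hBc : 0 < B * c₀ := mul_pos hB hpos
  have h4 : β * (4 * π * β) < (2 * n + 2) * (4 * π * β) := by nlinarith
  have h5 := lt_of_mul_lt_mul_right h4 (by positivity)
  linarith

/-- Section 5.4: nonlinear Landau levels of the Chern–Simons–Schrödinger model.
Existence and uniqueness of the radial solution iff 2n > β - 2. -/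
theorem chern_simons_landau_levels (B β : ℝ) (hB : 0 < B) (hβ : 0 < β) (n : ℕ) :
    ((β - 2 < 2 * (n : ℝ)) →
      ∃! ψ : R2 → ℝ, RadSym ψ ∧ ContDiff ℝ 2 ψ ∧
        (∀ x : R2, -lap ψ x = 4 * π * β * ‖x‖ ^ (2*n) *
          Real.exp (-B * ‖x‖ ^ 2 / 2) * Real.exp (ψ x)) ∧
        (∫ x : R2, ‖x‖ ^ (2*n) * Real.exp (-B * ‖x‖ ^ 2 / 2) *
          Real.exp (ψ x)) = 1) ∧
    (∀ ψ : R2 → ℝ, Continuous ψ →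
      IsWeakSol ψ (fun x => 4 * π * β * ‖x‖ ^ (2*n) *
        Real.exp (-B * ‖x‖ ^ 2 / 2) * Real.exp (ψ x)) →
      (∫ x : R2, ‖x‖ ^ (2*n) * Real.exp (-B * ‖x‖ ^ 2 / 2) *
        Real.exp (ψ x)) = 1 →
      Tendsto (fun x : R2 => ψ x / Real.log ‖x‖) (cobounded R2)
        (nhds (-(2*β))) →
      β - 2 < 2 * (n : ℝ)) := by
  refine ⟨fun hn => ?_, fun ψ hψ hw hm ht => lt_of_weak_solution hB hβ hψ hw hm ht⟩
  obtain ⟨ψ, hψ⟩ := exists_radial_solution hB hβ hn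
  exact ⟨ψ, hψ, fun φ hφ => eq_of_radial_solutions hB hβ hφ hψ⟩
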